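/- arXiv:1911.05315 — 6 statements merged into one kernel-verified Lean document; each statement's English description precedes it below -/
import Mathlib

section
/- (Carlson's lemma, odd coefficients) If f(z) = Σ_{n=0}^∞ a_n z^n is analytic in the open unit disk 𝔻 with |f(z)| ≤ 1 for all z ∈ 𝔻, then for every n ≥ 0 one has |a_{2n+1}| ≤ 1 − |a_0|² − |a_1|² − ⋯ − |a_n|². -/
open Filter Topology MeasureTheory

/-- A power series on the circle of radius `r`, as an element of `L²`. -/
theorem hasSum_fourierLp_of_hasSum_powerSeries {g : ℂ → ℂ} {b : ℕ → ℂ}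
    (hg : ∀ z : ℂ, ‖z‖ < 1 → HasSum (fun n : ℕ => b n * z ^ n) (g z)) {r : ℝ} (hr0 : 0 ≤ r)
    (hr1 : r < 1) :
    ∃ G : C(AddCircle (1 : ℝ), ℂ), (∀ t, G t = g (r * (AddCircle.toCircle t : ℂ))) ∧
      HasSum (fun n : ℕ => (b n * r ^ n) • fourierLp (T := (1 : ℝ)) 2 (n : ℤ))
        (ContinuousMap.toLp (E := ℂ) 2 AddCircle.haarAddCircle ℂ G) := by
  have hs : Summable fun n : ℕ => (b n * (r : ℂ) ^ n) • fourier (T := (1 : ℝ)) (n : ℤ) := by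
    refine Summable.of_norm ?_
    simp only [norm_smul, fourier_norm, mul_one]
    exact (hg r (by simpa [abs_of_nonneg hr0] using hr1)).summable.norm
  refine ⟨∑' n : ℕ, (b n * (r : ℂ) ^ n) • fourier (T := (1 : ℝ)) (n : ℤ), fun t => ?_, ?_⟩
  · refine (ContinuousMap.hasSum_apply hs.hasSum t).unique ?_
    have hz : ‖(r * (AddCircle.toCircle t : ℂ))‖ < 1 := by
      rwa [norm_mul, Circle.norm_coe, mul_one, Complex.norm_of_nonneg hr0]
    convert hg _ hz using 2 with n
    simp [fourier_apply, AddCircle.toCircle_nsmul, mul_pow, mul_assoc]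
  · simpa using (ContinuousMap.toLp (E := ℂ) 2 AddCircle.haarAddCircle ℂ).hasSum hs.hasSum

/-- If `‖g‖ ≤ ‖h‖` in the unit disk, where `h` is a polynomial, then the sum of the squared moduli
of finitely many coefficients of `g` is at most that of all the coefficients of `h`. -/
theorem sum_sq_norm_coeff_le_of_norm_le {g h : ℂ → ℂ} {b c : ℕ → ℂ}
    (hg : ∀ z : ℂ, ‖z‖ < 1 → HasSum (fun n : ℕ => b n * z ^ n) (g z)) {N : ℕ}
    (hh : ∀ z : ℂ, h z = ∑ k ∈ Finset.range N, c k * z ^ k)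
    (hgh : ∀ z : ℂ, ‖z‖ < 1 → ‖g z‖ ≤ ‖h z‖) (s : Finset ℕ) :
    ∑ k ∈ s, ‖b k‖ ^ 2 ≤ ∑ k ∈ Finset.range N, ‖c k‖ ^ 2 := by
  have ho : Orthonormal ℂ fun n : ℕ => fourierLp (T := (1 : ℝ)) 2 (n : ℤ) :=
    orthonormal_fourier.comp _ Nat.cast_injective
  have key : ∀ r : ℝ, 0 ≤ r → r < 1 →
      ∑ k ∈ s, ‖b k * r ^ k‖ ^ 2 ≤ ∑ k ∈ Finset.range N, ‖c k * r ^ k‖ ^ 2 := by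
    intro r hr0 hr1
    obtain ⟨G, hG, hGs⟩ := hasSum_fourierLp_of_hasSum_powerSeries hg hr0 hr1
    let d : ℕ → ℂ := fun k => if k < N then c k else 0
    have hd : ∀ z : ℂ, ‖z‖ < 1 → HasSum (fun n : ℕ => d n * z ^ n) (h z) := by
      intro z _
      rw [hh z, Finset.sum_congr rfl fun k hk =>
        show c k * z ^ k = d k * z ^ k by simp [d, Finset.mem_range.1 hk]]
      refine hasSum_sum_of_ne_finset_zero fun k hk => ?_
      simp [d, Finset.mem_range.not.1 hk]
    obtain ⟨H, hH, hHs⟩ := hasSum_fourierLp_of_hasSum_powerSeries hd hr0 hr1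
    have hle : ‖ContinuousMap.toLp (E := ℂ) 2 AddCircle.haarAddCircle ℂ G‖ ≤
        ‖ContinuousMap.toLp (E := ℂ) 2 AddCircle.haarAddCircle ℂ H‖ := by
      refine Lp.norm_le_norm_of_ae_le ?_
      filter_upwards [ContinuousMap.coeFn_toLp (p := 2) (𝕜 := ℂ) AddCircle.haarAddCircle G,
        ContinuousMap.coeFn_toLp (p := 2) (𝕜 := ℂ) AddCircle.haarAddCircle H] with t h1 h2
      rw [h1, h2, hG, hH]
      exact hgh _ (by rwa [norm_mul, Circle.norm_coe, mul_one, Complex.norm_of_nonneg hr0])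
    have hinner : ∀ k : ℕ, inner ℂ (fourierLp (T := (1 : ℝ)) 2 (k : ℤ))
        (ContinuousMap.toLp (E := ℂ) 2 AddCircle.haarAddCircle ℂ G) = b k * r ^ k := by
      intro k
      refine ((innerSL ℂ (fourierLp (T := (1 : ℝ)) 2 (k : ℤ))).hasSum hGs).unique ?_
      refine (hasSum_ite_eq k (b k * (r : ℂ) ^ k)).congr_fun fun j => ?_
      rw [innerSL_apply_apply, inner_smul_right, orthonormal_iff_ite.1 ho k j]
      by_cases hjk : j = k
      · simp [hjk]
      · simp [hjk, Ne.symm hjk]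
    have hbessel := ho.sum_inner_products_le (s := s)
      (ContinuousMap.toLp (E := ℂ) 2 AddCircle.haarAddCircle ℂ G)
    simp only [hinner] at hbessel
    have hHeq : ContinuousMap.toLp (E := ℂ) 2 AddCircle.haarAddCircle ℂ H =
        ∑ k ∈ Finset.range N, (c k * (r : ℂ) ^ k) • fourierLp (T := (1 : ℝ)) 2 (k : ℤ) := by
      refine hHs.unique ?_
      rw [Finset.sum_congr rfl fun k hk => show (c k * (r : ℂ) ^ k) • fourierLp (T := (1 : ℝ)) 2
        (k : ℤ) = (d k * (r : ℂ) ^ k) • fourierLp (T := (1 : ℝ)) 2 (k : ℤ) by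
          simp [d, Finset.mem_range.1 hk]]
      refine hasSum_sum_of_ne_finset_zero fun k hk => ?_
      simp [d, Finset.mem_range.not.1 hk]
    have hHnorm : ‖ContinuousMap.toLp (E := ℂ) 2 AddCircle.haarAddCircle ℂ H‖ ^ 2 =
        ∑ k ∈ Finset.range N, ‖c k * (r : ℂ) ^ k‖ ^ 2 := by
      rw [hHeq, ← RCLike.ofReal_inj (K := ℂ)]
      push_cast
      rw [← inner_self_eq_norm_sq_to_K (𝕜 := ℂ), ho.inner_sum]
      exact Finset.sum_congr rfl fun k _ => RCLike.conj_mul _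
    calc _ ≤ _ := hbessel
      _ ≤ _ := by gcongr
      _ = _ := hHnorm
  have hlim : ∀ (e : ℕ → ℂ) (u : Finset ℕ), Tendsto (fun r : ℝ => ∑ k ∈ u, ‖e k * (r : ℂ) ^ k‖ ^ 2)
      (𝓝[<] 1) (𝓝 (∑ k ∈ u, ‖e k‖ ^ 2)) := by
    intro e u
    have hc : Continuous fun r : ℝ => ∑ k ∈ u, ‖e k * (r : ℂ) ^ k‖ ^ 2 := by fun_prop
    simpa using (hc.tendsto 1).mono_left nhdsWithin_le_nhds
  refine le_of_tendsto_of_tendsto (hlim b s) (hlim c _) ?_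
  filter_upwards [Ioo_mem_nhdsLT (zero_lt_one' ℝ)] with r hr
  exact key r hr.1.le hr.2

/-- The power series of the product of a function with a polynomial. -/
theorem hasSum_powerSeries_mul_polynomial {f : ℂ → ℂ} {a : ℕ → ℂ} {z : ℂ}
    (hf : HasSum (fun n : ℕ => a n * z ^ n) (f z)) (c : ℕ → ℂ) (N : ℕ) :
    HasSum (fun j : ℕ => (∑ k ∈ Finset.range N, if k ≤ j then c k * a (j - k) else 0) * z ^ j)
      (f z * ∑ k ∈ Finset.range N, c k * z ^ k) := by
  rw [Finset.mul_sum]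
  refine HasSum.congr_fun (hasSum_sum fun k _ => ?_) fun j => Finset.sum_mul _ _ _
  rw [← hasSum_nat_add_iff' k, Finset.sum_eq_zero fun i hi => by
    simp [Finset.mem_range.1 hi], sub_zero]
  rw [mul_comm (f z)]
  refine (hf.mul_left (c k * z ^ k)).congr_fun fun j => ?_
  rw [if_pos (Nat.le_add_left k j), Nat.add_sub_cancel]
  ring

/-- Carlson's lemma, odd coefficients: if `f(z) = Σ aₙ zⁿ` is analytic in the unit disk with
`|f| ≤ 1`, then `|a_{2n+1}| ≤ 1 - |a₀|² - ⋯ - |aₙ|²` for all `n ≥ 0`. -/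
theorem stmt_12 (f : ℂ → ℂ) (a : ℕ → ℂ)
    (hf : ∀ z : ℂ, ‖z‖ < 1 → HasSum (fun n : ℕ => a n * z ^ n) (f z))
    (hb : ∀ z : ℂ, ‖z‖ < 1 → ‖f z‖ ≤ 1) (n : ℕ) :
    ‖a (2 * n + 1)‖ ≤ 1 - ∑ k ∈ Finset.range (n + 1), ‖a k‖ ^ 2 := by
  set S := ∑ k ∈ Finset.range (n + 1), ‖a k‖ ^ 2 with hS
  have hS0 : 0 ≤ S := by positivity
  obtain ⟨y, hy, hya⟩ : ∃ y : ℂ, ‖y‖ = 1 ∧ a (2 * n + 1) = y * ‖a (2 * n + 1)‖ :=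
    ⟨_, Complex.norm_exp_ofReal_mul_I (a (2 * n + 1)).arg, by
      rw [mul_comm (Complex.exp _), Complex.norm_mul_exp_arg_mul_I]⟩
  let c : ℕ → ℂ := fun k =>
    if k = 0 then 1 else if k ≤ n then 0 else y * (starRingEnd ℂ) (a (2 * n + 1 - k))
  have hc0 : c 0 = 1 := by simp [c]
  have hcmid : ∀ k, k ≠ 0 → k ≤ n → c k = 0 := fun k h0 hk => by simp [c, h0, hk]
  have hctop : ∀ k, n < k → c k = y * (starRingEnd ℂ) (a (2 * n + 1 - k)) := fun k hk => by
    simp [c, hk.not_ge, (Nat.zero_lt_of_lt hk).ne']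
  have hsplit : ∀ {M : Type} [AddCommMonoid M] (F : ℕ → M), (∀ k, k ≠ 0 → k ≤ n → F k = 0) →
      ∑ k ∈ Finset.range (2 * n + 2), F k =
        F 0 + ∑ k ∈ Finset.range (n + 1), F (2 * n + 1 - k) := by
    intro M _ F hF
    rw [show 2 * n + 2 = (n + 1) + (n + 1) by ring, Finset.sum_range_add,
      Finset.sum_eq_single_of_mem 0 (by simp) fun k hk h0 =>
        hF k h0 (Nat.lt_succ_iff.1 (Finset.mem_range.1 hk)), ← Finset.sum_range_reflect]
    congr 1
    refine Finset.sum_congr rfl fun k hk => ?_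
    have := Finset.mem_range.1 hk
    congr 1
    omega
  let b : ℕ → ℂ := fun j =>
    ∑ k ∈ Finset.range (2 * n + 2), if k ≤ j then c k * a (j - k) else 0
  have hblow : ∀ j ≤ n, b j = a j := by
    intro j hj
    refine (Finset.sum_eq_single_of_mem 0 (by simp) fun k _ h0 => ?_).trans (by simp [hc0])
    split_ifs with hk
    · simp [hcmid k h0 (hk.trans hj)]
    · rfl
  have hbtop : b (2 * n + 1) = y * ((‖a (2 * n + 1)‖ + S : ℝ) : ℂ) := by
    refine (hsplit _ fun k h0 hk => by simp [hcmid k h0 hk]).trans ?_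
    push_cast
    rw [mul_add, ← hya, hS]
    push_cast
    rw [Finset.mul_sum]
    congr 1
    · simp [hc0]
    · refine Finset.sum_congr rfl fun k hk => ?_
      have := Finset.mem_range.1 hk
      rw [if_pos (by omega), hctop _ (by omega), show 2 * n + 1 - (2 * n + 1 - k) = k by omega,
        mul_assoc, Complex.conj_mul']
  have hmain := sum_sq_norm_coeff_le_of_norm_le (b := b) (c := c)
    (g := fun z => f z * ∑ k ∈ Finset.range (2 * n + 2), c k * z ^ k)
    (fun z hz => hasSum_powerSeries_mul_polynomial (hf z hz) c _) (fun z => rfl)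
    (fun z hz => by
      rw [norm_mul]
      exact mul_le_of_le_one_left (norm_nonneg _) (hb z hz))
    (insert (2 * n + 1) (Finset.range (n + 1)))
  have hcsum : ∑ k ∈ Finset.range (2 * n + 2), ‖c k‖ ^ 2 = 1 + S := by
    rw [hsplit _ fun k h0 hk => by simp [hcmid k h0 hk], hc0, norm_one, one_pow]
    congr 1
    refine Finset.sum_congr rfl fun k hk => ?_
    have := Finset.mem_range.1 hk
    rw [hctop _ (by omega), show 2 * n + 1 - (2 * n + 1 - k) = k by omega, norm_mul, hy, one_mul,
      RCLike.norm_conj]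
  rw [Finset.sum_insert (by simp; omega), hbtop, hcsum, norm_mul, hy, one_mul, Complex.norm_real,
    Real.norm_of_nonneg (by positivity), Finset.sum_congr rfl fun k hk => by
      rw [hblow k (Nat.lt_succ_iff.1 (Finset.mem_range.1 hk))], ← hS] at hmain
  nlinarith [norm_nonneg (a (2 * n + 1))]
end

section
/- (Carlson's lemma, even coefficients) If f(z) = Σ_{n=0}^∞ a_n z^n is analytic in the open unit disk 𝔻 with |f(z)| ≤ 1 for all z ∈ 𝔻, then for every n ≥ 1 one has |a_{2n}| ≤ 1 − |a_0|² − ⋯ − |a_{n−1}|² − |a_n|²/(1 + |a_0|). -/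
open MeasureTheory AddCircle in
theorem Continuous.integrable_haarAddCircle {E : Type*} [NormedAddCommGroup E]
    {h : UnitAddCircle → E} (hc : Continuous h) : Integrable h haarAddCircle :=
  hc.integrable_of_hasCompactSupport (HasCompactSupport.of_compactSpace _)

open MeasureTheory AddCircle ComplexConjugate in
/-- Pairing two trigonometric polynomials through a continuous function gives a Toeplitz form in
the Fourier coefficients of that function. -/
theorem integral_conj_trigPoly_mul_mul_trigPoly (g : C(UnitAddCircle, ℂ)) {ι : Type*}
    (s : Finset ι) (x y : ι → ℂ) (u v : ι → ℤ) :
    ∫ t, conj (∑ i ∈ s, y i * fourier (v i) t) * (g t * ∑ j ∈ s, x j * fourier (u j) t)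
        ∂haarAddCircle =
      ∑ i ∈ s, ∑ j ∈ s, conj (y i) * x j * fourierCoeff g (v i - u j) := by
  have key : ∀ t : UnitAddCircle,
      conj (∑ i ∈ s, y i * fourier (v i) t) * (g t * ∑ j ∈ s, x j * fourier (u j) t) =
        ∑ i ∈ s, ∑ j ∈ s, conj (y i) * x j * (fourier (-(v i - u j)) t * g t) := by
    intro t
    rw [map_sum, Finset.mul_sum, Finset.sum_mul_sum]
    refine Finset.sum_congr rfl fun i _ ↦ Finset.sum_congr rfl fun j _ ↦ ?_
    rw [show -(v i - u j) = -v i + u j by ring, fourier_add, fourier_neg, map_mul]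
    ring
  have hterm : ∀ i j, Integrable
      (fun t ↦ conj (y i) * x j * (fourier (-(v i - u j)) t * g t)) haarAddCircle :=
    fun i j ↦ (continuous_const.mul
      ((fourier (-(v i - u j))).continuous.mul g.continuous)).integrable_haarAddCircle
  simp_rw [key]
  rw [integral_finsetSum _ fun i _ ↦ integrable_finsetSum _ fun j _ ↦ hterm i j]
  refine Finset.sum_congr rfl fun i _ ↦ ?_
  rw [integral_finsetSum _ fun j _ ↦ hterm i j]
  refine Finset.sum_congr rfl fun j _ ↦ ?_
  simp only [integral_const_mul, fourierCoeff, smul_eq_mul]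

open MeasureTheory AddCircle ComplexConjugate in
theorem integral_norm_sq_trigPoly {ι : Type*} (s : Finset ι) (x : ι → ℂ) (u : ι → ℤ)
    (hu : Set.InjOn u s) :
    ∫ t : UnitAddCircle, ‖∑ j ∈ s, x j * fourier (u j) t‖ ^ 2 ∂haarAddCircle =
      ∑ j ∈ s, ‖x j‖ ^ 2 := by
  classical
  have h := integral_conj_trigPoly_mul_mul_trigPoly (fourier 0) s x x u u
  rw [fourierCoeff_fourier] at h
  have hr : ∑ i ∈ s, ∑ j ∈ s, conj (x i) * x j * (Pi.single (0 : ℤ) (1 : ℂ) : ℤ → ℂ) (u i - u j) =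
      ((∑ j ∈ s, ‖x j‖ ^ 2 : ℝ) : ℂ) := by
    push_cast
    refine Finset.sum_congr rfl fun i hi ↦ ?_
    rw [Finset.sum_eq_single_of_mem i hi]
    · simp [Complex.conj_mul']
    · intro j hj hji
      rw [Pi.single_eq_of_ne, mul_zero]
      exact sub_ne_zero.2 fun e ↦ hji (hu hj hi e.symm)
  rw [hr] at h
  simp_rw [fourier_zero, one_mul, Complex.conj_mul'] at h
  exact_mod_cast h

open MeasureTheory AddCircle ComplexConjugate in
/-- The Toeplitz form of a continuous function bounded by one is a contraction. -/
theorem two_mul_re_toeplitz_le (g : C(UnitAddCircle, ℂ)) (hg : ∀ t, ‖g t‖ ≤ 1) {ι : Type*}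
    (s : Finset ι) (x y : ι → ℂ) (u v : ι → ℤ) (hu : Set.InjOn u s) (hv : Set.InjOn v s) :
    2 * (∑ i ∈ s, ∑ j ∈ s, conj (y i) * x j * fourierCoeff g (v i - u j)).re ≤
      ∑ j ∈ s, ‖x j‖ ^ 2 + ∑ i ∈ s, ‖y i‖ ^ 2 := by
  have hP : Continuous fun t : UnitAddCircle ↦ ∑ j ∈ s, x j * fourier (u j) t :=
    continuous_finsetSum _ fun j _ ↦ continuous_const.mul (fourier (u j)).continuous
  have hQ : Continuous fun t : UnitAddCircle ↦ ∑ i ∈ s, y i * fourier (v i) t :=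
    continuous_finsetSum _ fun j _ ↦ continuous_const.mul (fourier (v j)).continuous
  have hP2 : Continuous fun t : UnitAddCircle ↦ ‖∑ j ∈ s, x j * fourier (u j) t‖ ^ 2 :=
    hP.norm.pow 2
  have hQ2 : Continuous fun t : UnitAddCircle ↦ ‖∑ i ∈ s, y i * fourier (v i) t‖ ^ 2 :=
    hQ.norm.pow 2
  have hF : Continuous fun t : UnitAddCircle ↦ conj (∑ i ∈ s, y i * fourier (v i) t) *
      (g t * ∑ j ∈ s, x j * fourier (u j) t) :=
    (Complex.continuous_conj.comp hQ).mul (g.continuous.mul hP)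
  rw [← integral_conj_trigPoly_mul_mul_trigPoly, ← integral_norm_sq_trigPoly s x u hu,
    ← integral_norm_sq_trigPoly s y v hv,
    ← integral_add hP2.integrable_haarAddCircle hQ2.integrable_haarAddCircle]
  have hre := integral_re (𝕜 := ℂ) hF.integrable_haarAddCircle
  simp only [RCLike.re_eq_complex_re] at hre
  rw [← hre, ← integral_const_mul]
  refine integral_mono
    (continuous_const.mul (Complex.continuous_re.comp hF)).integrable_haarAddCircle
    (hP2.add hQ2).integrable_haarAddCircle fun t ↦ ?_
  set p := ∑ j ∈ s, x j * fourier (u j) t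
  set q := ∑ i ∈ s, y i * fourier (v i) t
  have h1 : (conj q * (g t * p)).re ≤ ‖q‖ * ‖p‖ := by
    refine (Complex.re_le_norm _).trans ?_
    rw [norm_mul, norm_mul, Complex.norm_conj]
    gcongr
    exact mul_le_of_le_one_left (norm_nonneg _) (hg t)
  change 2 * (conj q * (g t * p)).re ≤ ‖p‖ ^ 2 + ‖q‖ ^ 2
  nlinarith [sq_nonneg (‖p‖ - ‖q‖)]

open ComplexConjugate in
/-- Carlson's inequality for the Fourier coefficients of a continuous function on the circle which
is bounded by one and has no negative frequencies. -/
theorem norm_fourierCoeff_two_mul_le (g : C(UnitAddCircle, ℂ)) (hg : ∀ t, ‖g t‖ ≤ 1)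
    (hneg : ∀ k < 0, fourierCoeff g k = 0) (n : ℕ) (hn : 1 ≤ n) :
    ‖fourierCoeff g (2 * n : ℕ)‖ ≤ 1 - (∑ k ∈ Finset.range n, ‖fourierCoeff g k‖ ^ 2) -
      ‖fourierCoeff g n‖ ^ 2 / (1 + ‖fourierCoeff g 0‖) := by
  set c := fourierCoeff g with hc
  obtain ⟨w, hw, hwc⟩ : ∃ w : ℂ, ‖w‖ = 1 ∧ conj w * c (2 * n : ℕ) = ‖c (2 * n : ℕ)‖ := by
    obtain ⟨w, hw, hwc⟩ := RCLike.exists_norm_eq_mul_self (c (2 * n : ℕ))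
    exact ⟨conj w, by simpa using hw, by simpa using hwc.symm⟩
  set d : ℝ := 1 + ‖c 0‖ with hd
  have hd0 : 0 < d := by positivity
  let x : ℕ → ℂ := fun k ↦
    if k < n then w * conj (c k) else if k = n then w * conj (c n) / d else 1
  let y : ℕ → ℂ := fun k ↦ if k < n then c k else if k = n then c n / d else w
  let u : ℕ → ℤ := fun k ↦ if k ≤ n then 2 * n - k else 0
  let v : ℕ → ℤ := fun k ↦ if k ≤ n then k else 2 * n
  have hu : Set.InjOn u (Finset.range (n + 2)) := by
    intro i hi j hj h
    simp only [Finset.coe_range, Set.mem_Iio, u] at hi hj h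
    split_ifs at h <;> omega
  have hv : Set.InjOn v (Finset.range (n + 2)) := by
    intro i hi j hj h
    simp only [Finset.coe_range, Set.mem_Iio, v] at hi hj h
    split_ifs at h <;> omega
  have h := two_mul_re_toeplitz_le g hg (Finset.range (n + 2)) x y u v hu hv
  rw [← hc] at h
  set S := ∑ k ∈ Finset.range n, ‖c k‖ ^ 2 with hS
  have hxn : x n = w * conj (c n) / d := by simp [x]
  have hxn' : x (n + 1) = 1 := by simp [x]
  have hyn : y n = c n / d := by simp [y]
  have hyn' : y (n + 1) = w := by simp [y]
  have hun : u n = n := by simp [u]; ring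
  have hun' : u (n + 1) = 0 := by simp [u]
  have hvn : v n = n := by simp [v]
  have hvn' : v (n + 1) = 2 * n := by simp [v]
  have hxk : ∀ k ∈ Finset.range n, x k = w * conj (c k) := fun k hk ↦ by
    simp [x, Finset.mem_range.1 hk]
  have hyk : ∀ k ∈ Finset.range n, y k = c k := fun k hk ↦ by
    simp [y, Finset.mem_range.1 hk]
  have huk : ∀ k ∈ Finset.range n, u k = 2 * n - k := fun k hk ↦ by
    simp [u, (Finset.mem_range.1 hk).le]
  have hvk : ∀ k ∈ Finset.range n, v k = k := fun k hk ↦ by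
    simp [v, (Finset.mem_range.1 hk).le]
  have hx2 : ∑ k ∈ Finset.range (n + 2), ‖x k‖ ^ 2 = S + (‖c n‖ / d) ^ 2 + 1 := by
    rw [Finset.sum_range_succ, Finset.sum_range_succ, hxn, hxn', hS]
    congr 2
    · exact Finset.sum_congr rfl fun k hk ↦ by simp [hxk k hk, hw]
    · simp [hw, abs_of_pos hd0]
    · simp
  have hy2 : ∑ k ∈ Finset.range (n + 2), ‖y k‖ ^ 2 = S + (‖c n‖ / d) ^ 2 + 1 := by
    rw [Finset.sum_range_succ, Finset.sum_range_succ, hyn, hyn', hS]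
    congr 2
    · exact Finset.sum_congr rfl fun k hk ↦ by simp [hyk k hk]
    · simp [abs_of_pos hd0]
    · simp [hw]
  have hww : conj w * w = 1 := by rw [Complex.conj_mul', hw]; simp
  have hform : ∑ i ∈ Finset.range (n + 2), ∑ j ∈ Finset.range (n + 2),
      conj (y i) * x j * c (v i - u j) =
      S + (conj (c n) / d * (w * conj (c n) / d) * c 0 + conj (c n) / d * c n) +
        (S + conj (c n) * c n / d + ‖c (2 * n : ℕ)‖) := by
    rw [Finset.sum_range_succ, Finset.sum_range_succ]
    congr 2
    · rw [hS]
      push_cast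
      refine Finset.sum_congr rfl fun i hi ↦ ?_
      have hin := Finset.mem_range.1 hi
      rw [Finset.sum_range_succ, Finset.sum_range_succ, Finset.sum_eq_zero]
      · rw [hun, hun', hvk i hi, hyk i hi, hxn', hneg (i - n) (by omega), sub_zero,
          mul_zero, zero_add, zero_add, mul_one, Complex.conj_mul']
      · intro j hj
        have hjn := Finset.mem_range.1 hj
        rw [huk j hj, hvk i hi, hneg _ (by omega), mul_zero]
    · rw [Finset.sum_range_succ, Finset.sum_range_succ, Finset.sum_eq_zero]
      · rw [hun, hun', hvn, hyn, hxn, hxn', sub_self, sub_zero, zero_add, mul_one]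
        simp
      · intro j hj
        have hjn := Finset.mem_range.1 hj
        rw [huk j hj, hvn, hneg _ (by omega), mul_zero]
    · rw [Finset.sum_range_succ, Finset.sum_range_succ, hun, hun', hvn', hyn', hxn, hxn', hS]
      congr 1
      congr 1
      · push_cast
        refine Finset.sum_congr rfl fun j hj ↦ ?_
        rw [hxk j hj, huk j hj, sub_sub_cancel, ← mul_assoc, hww, one_mul, Complex.conj_mul']
      · rw [show (2 * n - n : ℤ) = n by ring, ← mul_div_assoc, ← mul_assoc, hww]
        ring
      · rw [sub_zero, mul_one, ← hwc]
        push_cast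
        rfl
  have hlow : -(‖c n‖ / d) ^ 2 * ‖c 0‖ ≤ (conj (c n) / d * (w * conj (c n) / d) * c 0).re := by
    have h1 := (abs_le.1 (Complex.abs_re_le_norm (conj (c n) / d * (w * conj (c n) / d) * c 0))).1
    have h2 : ‖conj (c n) / d * (w * conj (c n) / d) * c 0‖ = (‖c n‖ / d) ^ 2 * ‖c 0‖ := by
      simp only [norm_mul, norm_div, Complex.norm_conj, Complex.norm_real, Real.norm_eq_abs,
        abs_of_pos hd0, hw]
      ring
    linarith
  have hdiag : conj (c n) / d * c n = ((‖c n‖ ^ 2 / d : ℝ) : ℂ) := by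
    rw [div_mul_eq_mul_div, Complex.conj_mul']; push_cast; rfl
  have hdiag' : conj (c n) * c n / d = ((‖c n‖ ^ 2 / d : ℝ) : ℂ) := by
    rw [Complex.conj_mul']; push_cast; rfl
  rw [hx2, hy2, hform, hdiag, hdiag'] at h
  simp only [Complex.add_re, Complex.ofReal_re] at h
  have hq : (‖c n‖ / d) ^ 2 * (1 + ‖c 0‖) = ‖c n‖ ^ 2 / d := by
    rw [← hd]; field_simp
  linarith

open MeasureTheory AddCircle in
/-- The Fourier coefficients of an absolutely convergent one-sided Fourier series. -/
theorem fourierCoeff_tsum_smul_fourier {b : ℕ → ℂ} (hb : Summable fun m ↦ ‖b m‖) (k : ℤ) :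
    fourierCoeff (∑' m : ℕ, b m • (fourier (m : ℤ) : C(UnitAddCircle, ℂ)) : C(UnitAddCircle, ℂ)) k =
      ∑' m : ℕ, b m * (Pi.single (m : ℤ) (1 : ℂ) : ℤ → ℂ) k := by
  have hs : Summable fun m : ℕ ↦ b m • (fourier (m : ℤ) : C(UnitAddCircle, ℂ)) :=
    Summable.of_norm (by simpa [norm_smul, fourier_norm] using hb)
  have hpt : ∀ t : UnitAddCircle,
      HasSum (fun m : ℕ ↦ fourier (-k) t • (b m * fourier (m : ℤ) t))
        (fourier (-k) t • (∑' m : ℕ, b m • (fourier (m : ℤ) : C(UnitAddCircle, ℂ))) t) := fun t ↦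
    ((ContinuousMap.evalCLM ℂ t).hasSum hs.hasSum).const_smul _
  have hF : ∀ (m : ℕ) (t : UnitAddCircle),
      ‖fourier (-k) t • (b m * fourier (m : ℤ) t)‖ = ‖b m‖ := fun m t ↦ by
    rw [fourier_apply, fourier_apply, norm_smul, norm_mul, Circle.norm_coe, Circle.norm_coe,
      one_mul, mul_one]
  have hsum := hasSum_integral_of_summable_integral_norm (μ := haarAddCircle)
    (F := fun (m : ℕ) (t : UnitAddCircle) ↦ fourier (-k) t • (b m * fourier (m : ℤ) t))
    (fun m ↦ ((fourier (-k)).continuous.smul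
      (continuous_const.mul (fourier (m : ℤ)).continuous)).integrable_haarAddCircle) (by
      simp_rw [hF]
      simpa using hb)
  rw [fourierCoeff, integral_congr_ae (.of_forall fun t ↦ (hpt t).tsum_eq.symm), ← hsum.tsum_eq]
  refine tsum_congr fun m ↦ ?_
  rw [← fourierCoeff_fourier (T := 1), ← fourierCoeff.const_mul, fourierCoeff]

/-- Carlson's lemma, even coefficients: if `f(z) = Σ aₙ zⁿ` is analytic in the unit disk with
`|f| ≤ 1`, then `|a_{2n}| ≤ 1 - |a₀|² - ⋯ - |a_{n-1}|² - |aₙ|²/(1+|a₀|)` for all `n ≥ 1`. -/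
theorem stmt_13 (f : ℂ → ℂ) (a : ℕ → ℂ)
    (hf : ∀ z : ℂ, ‖z‖ < 1 → HasSum (fun n : ℕ => a n * z ^ n) (f z))
    (hb : ∀ z : ℂ, ‖z‖ < 1 → ‖f z‖ ≤ 1) (n : ℕ) (hn : 1 ≤ n) :
    ‖a (2 * n)‖ ≤
      1 - (∑ k ∈ Finset.range n, ‖a k‖ ^ 2) - ‖a n‖ ^ 2 / (1 + ‖a 0‖) := by
  have hdil : ∀ r : ℝ, 0 < r → r < 1 → ‖a (2 * n) * (r : ℂ) ^ (2 * n)‖ ≤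
      1 - (∑ k ∈ Finset.range n, ‖a k * (r : ℂ) ^ k‖ ^ 2) -
        ‖a n * (r : ℂ) ^ n‖ ^ 2 / (1 + ‖a 0‖) := by
    intro r hr0 hr1
    have hr : ‖(r : ℂ)‖ < 1 := by simpa [abs_of_pos hr0] using hr1
    have hsum : Summable fun m ↦ ‖a m * (r : ℂ) ^ m‖ := (hf r hr).summable.norm
    have hs : Summable fun m : ℕ ↦
        (a m * (r : ℂ) ^ m) • (fourier (m : ℤ) : C(UnitAddCircle, ℂ)) :=
      Summable.of_norm (by simpa only [norm_smul, fourier_norm, mul_one] using hsum)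
    have hcoeff := fourierCoeff_tsum_smul_fourier hsum
    set g : C(UnitAddCircle, ℂ) := ∑' m : ℕ, (a m * (r : ℂ) ^ m) • fourier (m : ℤ)
    have hnat : ∀ k : ℕ, fourierCoeff g k = a k * (r : ℂ) ^ k := by
      intro k
      rw [hcoeff, tsum_eq_single k]
      · simp
      · intro m hm
        rw [Pi.single_eq_of_ne (by exact_mod_cast hm.symm), mul_zero]
    have hneg : ∀ k < 0, fourierCoeff g k = 0 := by
      intro k hk
      rw [hcoeff, ← tsum_zero (α := ℂ) (β := ℕ)]
      refine tsum_congr fun m ↦ ?_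
      rw [Pi.single_eq_of_ne (by omega), mul_zero]
    have hbound : ∀ t, ‖g t‖ ≤ 1 := by
      intro t
      have hz : ‖(r : ℂ) * fourier 1 t‖ < 1 := by
        rwa [norm_mul, fourier_apply, Circle.norm_coe, mul_one]
      have h1 : HasSum (fun m : ℕ ↦ a m * (r : ℂ) ^ m * fourier (m : ℤ) t) (g t) :=
        (ContinuousMap.evalCLM ℂ t).hasSum hs.hasSum
      have h2 := hf _ hz
      have h3 : ∀ m : ℕ, fourier (m : ℤ) t = fourier 1 t ^ m := by
        intro m
        induction m with
        | zero => simp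
        | succ m ih => rw [Nat.cast_succ, fourier_add, ih, pow_succ]
      simp_rw [mul_pow, ← mul_assoc, ← h3] at h2
      rw [h1.unique h2]
      exact hb _ hz
    have h := norm_fourierCoeff_two_mul_le g hbound hneg n hn
    have h0 := hnat 0
    simp only [Nat.cast_zero, pow_zero, mul_one] at h0
    simpa only [hnat, h0] using h
  have hc : Continuous fun r : ℝ ↦ 1 - (∑ k ∈ Finset.range n, ‖a k * (r : ℂ) ^ k‖ ^ 2) -
      ‖a n * (r : ℂ) ^ n‖ ^ 2 / (1 + ‖a 0‖) - ‖a (2 * n) * (r : ℂ) ^ (2 * n)‖ := by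
    fun_prop
  have hlim := (hc.tendsto 1).mono_left (nhdsWithin_le_nhds (s := Set.Iio 1))
  have hpos := ge_of_tendsto hlim (b := 0) (by
    filter_upwards [Ioo_mem_nhdsLT (show (0 : ℝ) < 1 by norm_num)] with r hr
    exact sub_nonneg.2 (hdil r hr.1 hr.2))
  simpa using hpos
end

section
/- If f(z) = Σ_{n=1}^∞ a_n z^n is analytic in the open unit disk 𝔻 with f(0) = 0, |f(z)| ≤ 1 for all z ∈ 𝔻, and a = |a_1|, then for every r ∈ (0,1) one has Σ_{n=1}^∞ |a_n| r^n + (r^{−1}/(1+a) + 1/(1−r)) · Σ_{n=1}^∞ |a_n|² r^{2n} ≤ Ξ(a;r), where Ξ(a;r) = r a + r²/(1−r) + r a²/(1+a). -/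
open Finset Filter Topology

/-- Comparison of `L²` norms of power series on the unit circle. -/
theorem sum_sq_coeff_le_of_norm_le_on_circle (c d : ℕ → ℂ) (M N : ℕ)
    (hc : Summable fun n => ‖c n‖)
    (h : ∀ z : ℂ, ‖z‖ = 1 → ‖∑' n, c n * z ^ n‖ ≤ ‖∑ j ∈ range M, d j * z ^ j‖) :
    ∑ k ∈ range N, ‖c k‖ ^ 2 ≤ ∑ j ∈ range M, ‖d j‖ ^ 2 := by
  have : Fact ((0 : ℝ) < 1) := ⟨one_pos⟩
  let e : ℕ → C(AddCircle (1 : ℝ), ℂ) := fun n => fourier (n : ℤ)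
  let L := ContinuousMap.toLp (E := ℂ) 2 (@AddCircle.haarAddCircle (1 : ℝ) _) ℂ
  have ho : Orthonormal ℂ fun n : ℕ => L (e n) :=
    (orthonormal_fourier (T := (1 : ℝ))).comp _ Nat.cast_injective
  have he : ∀ n x, e n x = (fourier 1 x : ℂ) ^ n := by
    intro n x
    simp [e, fourier_apply, AddCircle.toCircle_nsmul]
  have hx : ∀ x : AddCircle (1 : ℝ), ‖(fourier 1 x : ℂ)‖ = 1 := fun x => by
    rw [fourier_apply, Circle.norm_coe]
  have hs : Summable fun n => c n • e n := by
    refine Summable.of_norm (hc.congr fun n => ?_)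
    rw [norm_smul, fourier_norm, mul_one]
  have hval : ∀ x, (∑' n, c n • e n) x = ∑' n, c n * (fourier 1 x : ℂ) ^ n := by
    intro x
    have := (ContinuousMap.evalCLM ℂ x).map_tsum hs
    simpa [he] using this
  have hnorm : ‖L (∑' n, c n • e n)‖ ≤ ‖L (∑ j ∈ range M, d j • e j)‖ := by
    apply MeasureTheory.Lp.norm_le_norm_of_ae_le
    filter_upwards [ContinuousMap.coeFn_toLp (p := 2) (𝕜 := ℂ) AddCircle.haarAddCircle
      (∑' n, c n • e n), ContinuousMap.coeFn_toLp (p := 2) (𝕜 := ℂ) AddCircle.haarAddCircle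
      (∑ j ∈ range M, d j • e j)] with x h1 h2
    rw [h1, h2, hval]
    simpa [he] using h _ (hx x)
  have hcoeff : ∀ k, inner ℂ (L (e k)) (L (∑' n, c n • e n)) = c k := by
    intro k
    have h1 := ((innerSL ℂ (L (e k))).comp L).map_tsum hs
    have h2 : ∀ n, inner ℂ (L (e k)) (L (e n)) = if k = n then (1 : ℂ) else 0 :=
      orthonormal_iff_ite.1 ho k
    rw [show inner ℂ (L (e k)) (L (∑' n, c n • e n)) =
      ∑' n, ((innerSL ℂ (L (e k))).comp L) (c n • e n) from h1, tsum_eq_single k]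
    · simp [show ‖L (e k)‖ = 1 from ho.1 k]
    · intro n hn
      simp [h2, hn.symm]
  have hd : ‖L (∑ j ∈ range M, d j • e j)‖ ^ 2 = ∑ j ∈ range M, ‖d j‖ ^ 2 := by
    have h1 := ho.inner_sum d d (range M)
    rw [← Complex.ofReal_inj]
    push_cast
    refine (inner_self_eq_norm_sq_to_K (𝕜 := ℂ) (L (∑ j ∈ range M, d j • e j))).symm.trans ?_
    simp only [map_sum, map_smul]
    exact h1.trans (sum_congr rfl fun j _ => RCLike.conj_mul _)
  calc ∑ k ∈ range N, ‖c k‖ ^ 2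
      = ∑ k ∈ range N, ‖inner ℂ (L (e k)) (L (∑' n, c n • e n))‖ ^ 2 := by simp only [hcoeff]
    _ ≤ ‖L (∑' n, c n • e n)‖ ^ 2 := ho.sum_inner_products_le _
    _ ≤ ‖L (∑ j ∈ range M, d j • e j)‖ ^ 2 := by gcongr
    _ = _ := hd

/-- Multiplication by a power series bounded by `1` on the unit disk is a contraction in `ℓ²`. -/
theorem sum_sq_conv_le_of_bounded (f : ℂ → ℂ) (a p : ℕ → ℂ)
    (hf : ∀ z : ℂ, ‖z‖ < 1 → HasSum (fun n : ℕ => a n * z ^ n) (f z))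
    (hb : ∀ z : ℂ, ‖z‖ < 1 → ‖f z‖ ≤ 1) (M N : ℕ) (hp : ∀ j, M ≤ j → p j = 0) :
    ∑ k ∈ range N, ‖∑ x ∈ antidiagonal k, a x.1 * p x.2‖ ^ 2 ≤ ∑ j ∈ range M, ‖p j‖ ^ 2 := by
  have key : ∀ ρ ∈ Set.Ioo (0 : ℝ) 1,
      ∑ k ∈ range N, ‖∑ x ∈ antidiagonal k, a x.1 * p x.2‖ ^ 2 * (ρ ^ k) ^ 2 ≤
        ∑ j ∈ range M, ‖p j‖ ^ 2 * (ρ ^ j) ^ 2 := by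
    intro ρ hρ
    have hn : ∀ z : ℂ, ‖z‖ = 1 → ‖(ρ : ℂ) * z‖ < 1 := fun z hz => by
      simpa [hz, abs_of_pos hρ.1] using hρ.2
    have hsa : ∀ z : ℂ, ‖z‖ = 1 → Summable fun n => ‖a n * (ρ * z) ^ n‖ := fun z hz =>
      (hf _ (hn z hz)).summable.norm
    have hsp : ∀ z : ℂ, Summable fun n => ‖p n * (ρ * z) ^ n‖ := fun z =>
      summable_of_ne_finset_zero (s := range M) fun j hj => by
        simp [hp j (by simpa using hj)]
    have hconv : ∀ (z : ℂ) (k : ℕ),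
        ∑ x ∈ antidiagonal k, a x.1 * (ρ * z) ^ x.1 * (p x.2 * (ρ * z) ^ x.2) =
          (∑ x ∈ antidiagonal k, a x.1 * p x.2) * ρ ^ k * z ^ k := by
      intro z k
      rw [sum_mul, sum_mul]
      refine sum_congr rfl fun x hx => ?_
      rw [← mem_antidiagonal.1 hx]
      ring
    have hle := sum_sq_coeff_le_of_norm_le_on_circle
      (fun k => (∑ x ∈ antidiagonal k, a x.1 * p x.2) * ρ ^ k) (fun j => p j * ρ ^ j) M N
      (by
        refine (summable_norm_sum_mul_antidiagonal_of_summable_norm (hsa 1 (by simp))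
          (hsp 1)).congr fun k => ?_
        rw [hconv]
        simp)
      (by
        intro z hz
        have h1 := tsum_mul_tsum_eq_tsum_sum_antidiagonal_of_summable_norm (hsa z hz) (hsp z)
        simp only [hconv] at h1
        rw [← h1, (hf _ (hn z hz)).tsum_eq, norm_mul,
          tsum_eq_sum (s := range M) fun j hj => by simp [hp j (by simpa using hj)]]
        refine (mul_le_of_le_one_left (norm_nonneg _) (hb _ (hn z hz))).trans_eq ?_
        congr 1
        exact sum_congr rfl fun j _ => by ring)
    simpa [mul_pow, abs_of_pos hρ.1] using hle
  have hl : Tendsto (fun ρ : ℝ => ∑ k ∈ range N,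
      ‖∑ x ∈ antidiagonal k, a x.1 * p x.2‖ ^ 2 * (ρ ^ k) ^ 2) (𝓝[<] 1)
      (𝓝 (∑ k ∈ range N, ‖∑ x ∈ antidiagonal k, a x.1 * p x.2‖ ^ 2 * ((1 : ℝ) ^ k) ^ 2)) :=
    (Continuous.tendsto (by fun_prop) _).mono_left nhdsWithin_le_nhds
  have hr : Tendsto (fun ρ : ℝ => ∑ j ∈ range M, ‖p j‖ ^ 2 * (ρ ^ j) ^ 2) (𝓝[<] 1)
      (𝓝 (∑ j ∈ range M, ‖p j‖ ^ 2 * ((1 : ℝ) ^ j) ^ 2)) :=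
    (Continuous.tendsto (by fun_prop) _).mono_left nhdsWithin_le_nhds
  simpa using le_of_tendsto_of_tendsto hl hr
    (by filter_upwards [Ioo_mem_nhdsLT (zero_lt_one' ℝ)] using key)

/-- The convolution contraction tested on the sequence `1, q (N - 1), …, q 0`. -/
theorem sum_sq_test_le_of_bounded (f : ℂ → ℂ) (a q : ℕ → ℂ) (h0 : a 0 = 0)
    (hf : ∀ z : ℂ, ‖z‖ < 1 → HasSum (fun n : ℕ => a n * z ^ n) (f z))
    (hb : ∀ z : ℂ, ‖z‖ < 1 → ‖f z‖ ≤ 1) (N : ℕ) :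
    ∑ k ∈ range (N + 1), ‖a (k + 1) + ∑ j ∈ range k, a (k - 1 - j + 1) * q (N - 1 - j)‖ ^ 2 ≤
      1 + ∑ i ∈ range N, ‖q i‖ ^ 2 := by
  let p : ℕ → ℂ := fun j => if j = 0 then 1 else if j ≤ N then q (N - j) else 0
  have h := sum_sq_conv_le_of_bounded f a p hf hb (N + 1) (N + 2) (fun j hj => by
    simp only [p]
    rw [if_neg (by omega), if_neg (by omega)])
  have hp : ∀ j < N, p (j + 1) = q (N - 1 - j) := fun j hj => by
    simp only [p]
    rw [if_neg (by omega), if_pos (by omega)]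
    congr 1
    omega
  rw [sum_range_succ' _ N, sum_congr (s₁ := range N) rfl fun j hj => show ‖p (j + 1)‖ ^ 2 = ‖q (N - 1 - j)‖ ^ 2 by
    rw [hp j (mem_range.1 hj)], sum_range_reflect (fun i => ‖q i‖ ^ 2) N, sum_range_succ'] at h
  have hc : ∀ k ∈ range (N + 1), ∑ x ∈ antidiagonal (k + 1), a x.1 * p x.2 =
      a (k + 1) + ∑ j ∈ range k, a (k - 1 - j + 1) * q (N - 1 - j) := by
    intro k hk
    rw [Nat.sum_antidiagonal_succ, h0, zero_mul, zero_add, ← Nat.sum_antidiagonal_swap]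
    simp only [Prod.fst_swap, Prod.snd_swap]
    rw [Nat.sum_antidiagonal_eq_sum_range_succ (fun i j => a (j + 1) * p i), sum_range_succ',
      add_comm]
    congr 1
    · simp [p]
    · refine sum_congr rfl fun j hj => ?_
      rw [mem_range] at hj hk
      rw [hp j (by omega), Nat.sub_add_eq, Nat.sub_right_comm]
  rw [sum_congr rfl fun k hk => by rw [hc k hk]] at h
  simpa [h0, p, add_comm] using h

theorem exists_norm_one_eq_norm_mul (w : ℂ) : ∃ u : ℂ, ‖u‖ = 1 ∧ w = ‖w‖ * u := by
  rcases eq_or_ne w 0 with rfl | hw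
  · exact ⟨1, by simp⟩
  · have : (‖w‖ : ℂ) ≠ 0 := by simpa using hw
    exact ⟨w / ‖w‖, by simp [hw], by field_simp⟩

/-- Carlson's inequality for coefficients of even index of `f`. -/
theorem norm_coeff_even_le (f : ℂ → ℂ) (a : ℕ → ℂ) (h0 : a 0 = 0)
    (hf : ∀ z : ℂ, ‖z‖ < 1 → HasSum (fun n : ℕ => a n * z ^ n) (f z))
    (hb : ∀ z : ℂ, ‖z‖ < 1 → ‖f z‖ ≤ 1) (n : ℕ) :
    ‖a (2 * n + 2)‖ ≤ 1 - ∑ k ∈ range (n + 1), ‖a (k + 1)‖ ^ 2 := by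
  obtain ⟨u, hu, hw⟩ := exists_norm_one_eq_norm_mul (a (2 * n + 2))
  let q : ℕ → ℂ := fun i => if i ≤ n then u * star (a (i + 1)) else 0
  have hq0 : ∀ i ≥ n + 1, q i = 0 := fun i hi => if_neg (by omega)
  have hq1 : ∀ i ∈ range (n + 1), q i = u * star (a (i + 1)) := fun i hi =>
    if_pos (by rw [mem_range] at hi; omega)
  have h := sum_sq_test_le_of_bounded f a q h0 hf hb (2 * n + 1)
  rw [sum_range_succ, eventually_constant_sum (u := fun i => ‖q i‖ ^ 2) (fun i hi => by simp [hq0 i hi])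
    (show 2 * n + 1 ≥ n + 1 by omega)] at h
  have hlast : ∑ j ∈ range (2 * n + 1), a (2 * n + 1 - 1 - j + 1) * q (2 * n + 1 - 1 - j) =
      (∑ k ∈ range (n + 1), ‖a (k + 1)‖ ^ 2 : ℝ) * u := by
    rw [sum_range_reflect (fun i => a (i + 1) * q i),
      eventually_constant_sum (fun i hi => by simp [hq0 i hi])
      (show 2 * n + 1 ≥ n + 1 by omega), Complex.ofReal_sum, sum_mul]
    refine sum_congr rfl fun i hi => ?_
    have := Complex.mul_conj' (a (i + 1))
    rw [hq1 i hi, Complex.ofReal_pow, ← this]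
    simp only [RCLike.star_def]
    ring
  have hfirst : ∑ k ∈ range (n + 1), ‖a (k + 1)‖ ^ 2 ≤ ∑ k ∈ range (2 * n + 1),
      ‖a (k + 1) + ∑ j ∈ range k, a (k - 1 - j + 1) * q (2 * n + 1 - 1 - j)‖ ^ 2 := by
    refine le_trans (le_of_eq (sum_congr rfl fun k hk => ?_)) (sum_le_sum_of_subset_of_nonneg
      (range_mono (show n + 1 ≤ 2 * n + 1 by omega)) fun _ _ _ => sq_nonneg _)
    rw [sum_eq_zero, add_zero]
    intro j hj
    rw [mem_range] at hj hk
    rw [hq0 _ (by omega), mul_zero]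
  have hnq : ∑ i ∈ range (n + 1), ‖q i‖ ^ 2 = ∑ k ∈ range (n + 1), ‖a (k + 1)‖ ^ 2 :=
    sum_congr rfl fun i hi => by rw [hq1 i hi, norm_mul, norm_star, hu, one_mul]
  set S := ∑ k ∈ range (n + 1), ‖a (k + 1)‖ ^ 2 with hS
  have hS0 : 0 ≤ S := sum_nonneg fun _ _ => sq_nonneg _
  rw [hlast, hnq, show 2 * n + 1 + 1 = 2 * n + 2 from rfl] at h
  have hnorm : ‖a (2 * n + 2) + S * u‖ = ‖a (2 * n + 2)‖ + S := by
    conv_lhs => rw [hw]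
    rw [← add_mul, ← Complex.ofReal_add, norm_mul, hu, mul_one, Complex.norm_of_nonneg]
    positivity
  rw [hnorm] at h
  have := norm_nonneg (a (2 * n + 2))
  nlinarith

/-- Carlson's inequality for coefficients of odd index of `f`. -/
theorem norm_coeff_odd_le (f : ℂ → ℂ) (a : ℕ → ℂ) (h0 : a 0 = 0)
    (hf : ∀ z : ℂ, ‖z‖ < 1 → HasSum (fun n : ℕ => a n * z ^ n) (f z))
    (hb : ∀ z : ℂ, ‖z‖ < 1 → ‖f z‖ ≤ 1) (n : ℕ) :
    ‖a (2 * n + 3)‖ ≤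
      1 - ∑ k ∈ range (n + 1), ‖a (k + 1)‖ ^ 2 - ‖a (n + 2)‖ ^ 2 / (1 + ‖a 1‖) := by
  obtain ⟨u, hu, hw⟩ := exists_norm_one_eq_norm_mul (a (2 * n + 3))
  set ν : ℝ := 1 / (1 + ‖a 1‖) with hν
  have hν0 : 0 < ν := by positivity
  have hν1 : ν * ‖a 1‖ = 1 - ν := by rw [hν]; field_simp; ring
  let q : ℕ → ℂ := fun i =>
    if i ≤ n then u * star (a (i + 1)) else if i = n + 1 then ν * u * star (a (n + 2)) else 0
  have hq0 : ∀ i ≥ n + 2, q i = 0 := fun i hi => by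
    simp only [q]
    rw [if_neg (by omega), if_neg (by omega)]
  have hq1 : ∀ i ∈ range (n + 1), q i = u * star (a (i + 1)) := fun i hi =>
    if_pos (by rw [mem_range] at hi; omega)
  have hq2 : q (n + 1) = ν * u * star (a (n + 2)) := by simp [q]
  have h := sum_sq_test_le_of_bounded f a q h0 hf hb (2 * n + 2)
  rw [sum_range_succ, eventually_constant_sum (u := fun i => ‖q i‖ ^ 2) (fun i hi => by simp [hq0 i hi])
    (show 2 * n + 2 ≥ n + 2 by omega), sum_range_succ _ (n + 1)] at h
  have hlast : ∑ j ∈ range (2 * n + 2), a (2 * n + 2 - 1 - j + 1) * q (2 * n + 2 - 1 - j) =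
      (∑ k ∈ range (n + 1), ‖a (k + 1)‖ ^ 2 + ν * ‖a (n + 2)‖ ^ 2 : ℝ) * u := by
    rw [sum_range_reflect (fun i => a (i + 1) * q i),
      eventually_constant_sum (fun i hi => by simp [hq0 i hi])
      (show 2 * n + 2 ≥ n + 2 by omega), sum_range_succ, Complex.ofReal_add, Complex.ofReal_sum,
      add_mul, sum_mul, hq2]
    congr 1
    · refine sum_congr rfl fun i hi => ?_
      rw [hq1 i hi, Complex.ofReal_pow, ← Complex.mul_conj' (a (i + 1))]
      simp only [RCLike.star_def]
      ring
    · rw [Complex.ofReal_mul, Complex.ofReal_pow, ← Complex.mul_conj' (a (n + 2))]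
      simp only [RCLike.star_def]
      ring
  have hmid : a (n + 1 + 1) +
      ∑ j ∈ range (n + 1), a (n + 1 - 1 - j + 1) * q (2 * n + 2 - 1 - j) =
      a (n + 2) + a 1 * (ν * u * star (a (n + 2))) := by
    rw [sum_range_succ, sum_eq_zero, zero_add, show 2 * n + 2 - 1 - n = n + 1 by omega, hq2]
    · simp
    · intro j hj
      rw [mem_range] at hj
      rw [hq0 _ (by omega), mul_zero]
  have hfirst : ∑ k ∈ range (n + 1), ‖a (k + 1)‖ ^ 2 +
      ‖a (n + 2) + a 1 * (ν * u * star (a (n + 2)))‖ ^ 2 ≤ ∑ k ∈ range (2 * n + 2),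
      ‖a (k + 1) + ∑ j ∈ range k, a (k - 1 - j + 1) * q (2 * n + 2 - 1 - j)‖ ^ 2 := by
    refine le_trans (le_of_eq ?_) (sum_le_sum_of_subset_of_nonneg
      (range_mono (show n + 2 ≤ 2 * n + 2 by omega)) fun _ _ _ => sq_nonneg _)
    rw [sum_range_succ _ (n + 1), hmid]
    congr 1
    refine sum_congr rfl fun k hk => ?_
    rw [sum_eq_zero, add_zero]
    intro j hj
    rw [mem_range] at hj hk
    rw [hq0 _ (by omega), mul_zero]
  have hnq : ∑ i ∈ range (n + 1), ‖q i‖ ^ 2 = ∑ k ∈ range (n + 1), ‖a (k + 1)‖ ^ 2 :=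
    sum_congr rfl fun i hi => by rw [hq1 i hi, norm_mul, norm_star, hu, one_mul]
  have hnq' : ‖q (n + 1)‖ = ν * ‖a (n + 2)‖ := by
    rw [hq2, norm_mul, norm_mul, norm_star, hu, mul_one, Complex.norm_of_nonneg hν0.le]
  set S := ∑ k ∈ range (n + 1), ‖a (k + 1)‖ ^ 2 with hS
  have hS0 : 0 ≤ S := sum_nonneg fun _ _ => sq_nonneg _
  rw [hlast, hnq, hnq', show 2 * n + 2 + 1 = 2 * n + 3 from rfl] at h
  have hnorm : ‖a (2 * n + 3) + (S + ν * ‖a (n + 2)‖ ^ 2 : ℝ) * u‖ =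
      ‖a (2 * n + 3)‖ + (S + ν * ‖a (n + 2)‖ ^ 2) := by
    conv_lhs => rw [hw]
    rw [← add_mul, ← Complex.ofReal_add, norm_mul, hu, mul_one, Complex.norm_of_nonneg]
    positivity
  have hlow : ν * ‖a (n + 2)‖ ≤ ‖a (n + 2) + a 1 * (ν * u * star (a (n + 2)))‖ := by
    have h1 := norm_sub_le_norm_add (a (n + 2)) (a 1 * (ν * u * star (a (n + 2))))
    rw [norm_mul (a 1), norm_mul, norm_mul, norm_star, hu, mul_one,
      Complex.norm_of_nonneg hν0.le] at h1
    linear_combination h1 + ‖a (n + 2)‖ * hν1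
  have hlow2 := pow_le_pow_left₀ (by positivity) hlow 2
  rw [hnorm] at h
  have h3 : (‖a (2 * n + 3)‖ + (S + ν * ‖a (n + 2)‖ ^ 2)) ^ 2 ≤ 1 := by linarith
  have h4 := (sq_le_one_iff₀ (by positivity)).1 h3
  have h5 : ‖a (n + 2)‖ ^ 2 / (1 + ‖a 1‖) = ν * ‖a (n + 2)‖ ^ 2 := by rw [hν]; ring
  linarith

/-- If `f(z) = Σ_{n≥1} aₙ zⁿ` is analytic in the unit disk with `f(0) = 0`, `|f| ≤ 1` and
`a = |a₁|`, then for `r ∈ (0,1)`,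
`Σ_{n≥1} |aₙ| rⁿ + (r⁻¹/(1+a) + 1/(1-r)) Σ_{n≥1} |aₙ|² r^{2n} ≤ Ξ(a;r)`,
where `Ξ(a;r) = ra + r²/(1-r) + ra²/(1+a)`. -/
theorem stmt_15 (f : ℂ → ℂ) (a : ℕ → ℂ) (h0 : a 0 = 0)
    (hf : ∀ z : ℂ, ‖z‖ < 1 → HasSum (fun n : ℕ => a n * z ^ n) (f z))
    (hb : ∀ z : ℂ, ‖z‖ < 1 → ‖f z‖ ≤ 1)
    (r : ℝ) (hr0 : 0 < r) (hr1 : r < 1) :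
    (∑' n : ℕ, ‖a (n + 1)‖ * r ^ (n + 1)) +
      (r⁻¹ / (1 + ‖a 1‖) + 1 / (1 - r)) *
        ∑' n : ℕ, ‖a (n + 1)‖ ^ 2 * r ^ (2 * (n + 1)) ≤
      r * ‖a 1‖ + r ^ 2 / (1 - r) + r * ‖a 1‖ ^ 2 / (1 + ‖a 1‖) := by
  have hr : 0 < 1 - r := by linarith
  have heven := norm_coeff_even_le f a h0 hf hb
  have hodd := norm_coeff_odd_le f a h0 hf hb
  have hS : ∀ n, ∑ k ∈ range (n + 1), ‖a (k + 1)‖ ^ 2 ≤ 1 := fun n => by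
    linarith [heven n, norm_nonneg (a (2 * n + 2))]
  have hpart : ∀ n, ∑ k ∈ range (2 * n + 1), ‖a (k + 1)‖ * r ^ (k + 1) +
      (r⁻¹ / (1 + ‖a 1‖) + 1 / (1 - r)) *
        ∑ k ∈ range (n + 1), ‖a (k + 1)‖ ^ 2 * r ^ (2 * (k + 1)) +
      r ^ (2 * n + 2) / (1 - r) * (1 - ∑ k ∈ range (n + 1), ‖a (k + 1)‖ ^ 2) ≤
      r * ‖a 1‖ + r ^ 2 / (1 - r) + r * ‖a 1‖ ^ 2 / (1 + ‖a 1‖) := by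
    intro n
    induction n with
    | zero =>
      apply le_of_eq
      simp
      field_simp
      ring
    | succ n ih =>
      refine le_trans ?_ ih
      have h1 := mul_le_mul_of_nonneg_right (heven n) (pow_pos hr0 (2 * n + 2)).le
      have h2 := mul_le_mul_of_nonneg_right (hodd n) (pow_pos hr0 (2 * n + 3)).le
      rw [show 2 * (n + 1) + 1 = 2 * n + 1 + 1 + 1 by ring, sum_range_succ _ (2 * n + 1 + 1),
        sum_range_succ _ (2 * n + 1), sum_range_succ _ (n + 1), sum_range_succ _ (n + 1)]
      set S := ∑ k ∈ range (n + 1), ‖a (k + 1)‖ ^ 2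
      have key : (r⁻¹ / (1 + ‖a 1‖) + 1 / (1 - r)) * (‖a (n + 2)‖ ^ 2 * r ^ (2 * (n + 1 + 1))) +
          r ^ (2 * (n + 1) + 2) / (1 - r) * (1 - (S + ‖a (n + 2)‖ ^ 2)) =
          r ^ (2 * n + 2) / (1 - r) * (1 - S) - (1 - S) * r ^ (2 * n + 2) -
          (1 - S - ‖a (n + 2)‖ ^ 2 / (1 + ‖a 1‖)) * r ^ (2 * n + 3) := by
        field_simp
        ring
      linear_combination h1 + h2 + key
  have hs1 : Summable fun n : ℕ => ‖a (n + 1)‖ * r ^ (n + 1) := by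
    have := (hf r (by simpa [abs_of_pos hr0] using hr1)).summable.norm
    simp only [norm_mul, norm_pow, Complex.norm_of_nonneg hr0.le] at this
    exact (summable_nat_add_iff 1).2 this
  have hs2 : Summable fun n : ℕ => ‖a (n + 1)‖ ^ 2 * r ^ (2 * (n + 1)) := by
    refine Summable.of_nonneg_of_le (fun n => by positivity) (fun n => ?_)
      ((summable_nat_add_iff 1).2 (summable_geometric_of_lt_one (sq_nonneg r) (by nlinarith)))
    rw [pow_mul]
    refine mul_le_of_le_one_left (by positivity) (le_trans ?_ (hS n))
    exact single_le_sum (f := fun k => ‖a (k + 1)‖ ^ 2) (fun _ _ => sq_nonneg _)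
      (self_mem_range_succ n)
  have ht1 := hs1.hasSum.tendsto_sum_nat.comp
    (tendsto_atTop_mono (fun n => show n ≤ 2 * n + 1 by omega) tendsto_id)
  have ht2 := (hs2.hasSum.tendsto_sum_nat.comp (tendsto_add_atTop_nat 1)).const_mul
    (r⁻¹ / (1 + ‖a 1‖) + 1 / (1 - r))
  refine le_of_tendsto' (ht1.add ht2) fun n => le_trans ?_ (hpart n)
  have : 0 ≤ r ^ (2 * n + 2) / (1 - r) * (1 - ∑ k ∈ range (n + 1), ‖a (k + 1)‖ ^ 2) :=
    mul_nonneg (by positivity) (by linarith [hS n])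
  simpa using this
end

section
/- (Bohr's inequality) If f(z) = Σ_{n=0}^∞ a_n z^n is analytic in the open unit disk 𝔻 with |f(z)| ≤ 1 for all z ∈ 𝔻, then Σ_{n=1}^∞ |a_n| r^n ≤ 1 − |a_0| for every r with 0 ≤ r ≤ 1/3. -/
open Complex Metric Real in
theorem DiffContOnCl.circleAverage_div_pow_mul {g : ℂ → ℂ} {R : ℝ} (hR : 0 < R)
    (hg : DiffContOnCl ℂ g (ball 0 R)) (n : ℕ) :
    Real.circleAverage (fun z ↦ (R / z) ^ n * g z) 0 R
      = iteratedDeriv n g 0 / n.factorial * R ^ n := by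
  have h := hg.circleIntegral_one_div_sub_center_pow_smul hR n
  have hfun : (fun z : ℂ ↦ (R / z) ^ n * g z) = fun z : ℂ ↦ (R : ℂ) ^ n • ((1 / z ^ n) * g z) := by
    ext z
    simp only [div_pow, smul_eq_mul]
    ring
  have hpi : (2 * π * I : ℂ) ≠ 0 := two_pi_I_ne_zero
  rw [hfun, circleAverage_fun_smul, circleAverage_eq_circleIntegral hR.ne']
  have hint : (∮ z in C(0, R), (z - 0)⁻¹ • (1 / z ^ n * g z))
      = ∮ z in C(0, R), (1 / (z - 0) ^ (n + 1)) • g z := by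
    congr 1
    ext z
    simp only [sub_zero, smul_eq_mul, pow_succ, one_div, mul_inv]
    ring
  rw [hint, h]
  simp only [smul_eq_mul]
  field_simp

theorem Complex.exists_norm_eq_one_mul_eq_norm (z : ℂ) : ∃ u : ℂ, ‖u‖ = 1 ∧ u * z = ‖z‖ := by
  rcases eq_or_ne z 0 with rfl | hz
  · exact ⟨1, by simp⟩
  · have hz' : (‖z‖ : ℂ) ≠ 0 := by simpa using hz
    refine ⟨‖z‖ / z, by simp [hz], by field_simp⟩

open Complex Metric Real ComplexConjugate in
/-- **Carathéodory's coefficient inequality** for functions with nonnegative real part. -/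
theorem DiffContOnCl.norm_iteratedDeriv_div_factorial_mul_pow_le {g : ℂ → ℂ} {R : ℝ} (hR : 0 < R)
    (hg : DiffContOnCl ℂ g (ball 0 R)) (hre : ∀ z ∈ sphere (0 : ℂ) R, 0 ≤ (g z).re)
    {n : ℕ} (hn : n ≠ 0) :
    ‖iteratedDeriv n g 0‖ / n.factorial * R ^ n ≤ 2 * (g 0).re := by
  have hRC : (R : ℂ) ≠ 0 := by exact_mod_cast hR.ne'
  obtain ⟨v, hv, hvg⟩ := exists_norm_eq_one_mul_eq_norm (iteratedDeriv n g 0)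
  have hcont : ContinuousOn g (sphere 0 R) := hg.continuousOn_ball.mono sphere_subset_closedBall
  have hne : ∀ z ∈ sphere (0 : ℂ) R, z ≠ 0 := fun z hz ↦ ne_of_mem_sphere hz hR.ne'
  have h1 : Real.circleAverage (fun z ↦ 2 * g z) 0 R = 2 * g 0 := by
    have := (abs_of_pos hR).symm ▸ hg
    exact DiffContOnCl.circleAverage (f := fun z ↦ 2 * g z) (this.const_smul (2 : ℂ))
  have h2 : Real.circleAverage (fun z ↦ -v * ((R / z) ^ n * g z)) 0 R
      = -(‖iteratedDeriv n g 0‖ / n.factorial * R ^ n) := by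
    have := circleAverage_fun_smul (a := -v) (f := fun z : ℂ ↦ (R / z) ^ n * g z) (c := 0) (R := R)
    simp only [smul_eq_mul] at this
    rw [this, hg.circleAverage_div_pow_mul hR, ← hvg]
    ring
  have h3 : Real.circleAverage (fun z ↦ -conj v * ((z / R) ^ n * g z)) 0 R = 0 := by
    have hd : DiffContOnCl ℂ (fun z ↦ -conj v * ((z / R) ^ n * g z)) (ball 0 |R|) := by
      rw [abs_of_pos hR]
      have hp : Differentiable ℂ fun z : ℂ ↦ -conj v * (z / R) ^ n := by fun_prop
      simpa only [smul_eq_mul, mul_assoc] using hp.diffContOnCl.smul hg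
    rw [hd.circleAverage]
    simp [hn]
  have i1 : CircleIntegrable (fun z ↦ 2 * g z) 0 R :=
    (continuousOn_const.mul hcont).circleIntegrable hR.le
  have i2 : CircleIntegrable (fun z ↦ -v * ((R / z) ^ n * g z)) 0 R :=
    (continuousOn_const.mul
      (((continuousOn_const.div continuousOn_id hne).pow n).mul hcont)).circleIntegrable hR.le
  have i3 : CircleIntegrable (fun z ↦ -conj v * ((z / R) ^ n * g z)) 0 R :=
    (continuousOn_const.mul
      (((continuousOn_id.div_const _).pow n).mul hcont)).circleIntegrable hR.le
  have hsum := circleAverage_fun_add (i1.add i2) i3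
  simp only [Pi.add_apply] at hsum
  have hsum' := circleAverage_add i1 i2
  rw [hsum', h1, h2, h3] at hsum
  have hpos := circleAverage_nonneg_of_nonneg (c := 0) (R := R) (f := reCLM ∘ fun z ↦
    2 * g z + -v * ((R / z) ^ n * g z) + -conj v * ((z / R) ^ n * g z)) (by
      intro z hz
      rw [abs_of_pos hR] at hz
      have hz0 := hne z hz
      have hzn : ‖z‖ = R := by simpa using hz
      have hconj : z / R = conj (R / z) := by
        rw [map_div₀, conj_ofReal, div_eq_div_iff hRC (by simpa using hz0), mul_conj,
          normSq_eq_norm_sq, hzn]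
        push_cast
        ring
      have hw : ‖v * (R / z) ^ n‖ = 1 := by
        simp [hv, hzn, abs_of_pos hR, hR.ne']
      have hform : 2 * g z + -v * ((R / z) ^ n * g z) + -conj v * ((z / R) ^ n * g z)
          = ((2 - 2 * (v * (R / z) ^ n).re : ℝ) : ℂ) * g z := by
        have := add_conj (v * (R / z) ^ n)
        rw [map_mul, map_pow, ← hconj] at this
        push_cast at this ⊢
        linear_combination -g z * this
      simp only [Function.comp_apply, reCLM_apply]
      rw [hform, re_ofReal_mul]
      exact mul_nonneg (by linarith [re_le_norm (v * (R / z) ^ n)]) (hre z hz))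
  have hcomm := reCLM.circleAverage_comp_comm ((i1.add i2).add i3)
  simp only [Pi.add_def] at hcomm
  rw [hcomm, hsum] at hpos
  have hcast : (2 * g 0 + -(‖iteratedDeriv n g 0‖ / n.factorial * R ^ n) + 0 : ℂ)
      = 2 * g 0 - ((‖iteratedDeriv n g 0‖ / n.factorial * R ^ n : ℝ) : ℂ) := by
    push_cast
    ring
  rw [hcast, reCLM_apply, sub_re, ofReal_re] at hpos
  simpa using hpos

open Metric FormalMultilinearSeries in
theorem hasFPowerSeriesOnBall_ofScalars_of_hasSum {f : ℂ → ℂ} {a : ℕ → ℂ}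
    (hf : ∀ z : ℂ, ‖z‖ < 1 → HasSum (fun n : ℕ ↦ a n * z ^ n) (f z)) :
    HasFPowerSeriesOnBall f (ofScalars ℂ a) 0 1 where
  r_le := by
    refine ENNReal.le_of_forall_nnreal_lt fun r hr ↦ ?_
    have hr1 : (r : ℝ) < 1 := by exact_mod_cast hr
    refine le_radius_of_tendsto (l := 0) _ ?_
    have h := (hf (r : ℝ) (by simpa using hr1)).summable.tendsto_atTop_zero.norm
    simpa using h
  r_pos := one_pos
  hasSum := by
    intro y hy
    have hy1 : ‖y‖ < 1 := by simpa [← ofReal_norm] using hy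
    simpa [ofScalars_apply_eq, mul_comm] using hf y hy1

open Complex Metric in
/-- If `f` is bounded by `1` on the unit disk, its coefficients satisfy `|aₙ| ≤ 2 (1 - |a₀|)`. -/
theorem norm_coeff_le_of_norm_le_one {f : ℂ → ℂ} {a : ℕ → ℂ}
    (hf : ∀ z : ℂ, ‖z‖ < 1 → HasSum (fun n : ℕ ↦ a n * z ^ n) (f z))
    (hb : ∀ z : ℂ, ‖z‖ < 1 → ‖f z‖ ≤ 1) {n : ℕ} (hn : n ≠ 0) :
    ‖a n‖ ≤ 2 * (1 - ‖a 0‖) := by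
  have hps := hasFPowerSeriesOnBall_ofScalars_of_hasSum hf
  have hf0 : f 0 = a 0 := by
    refine (hf 0 (by simp)).unique ?_
    convert hasSum_single 0 fun m hm ↦ ?_ using 1
    · simp
    · simp [hm]
  obtain ⟨w, hw, hwa⟩ := exists_norm_eq_one_mul_eq_norm (a 0)
  have hder : iteratedDeriv n f 0 = n.factorial * a n := by
    have := hps.factorial_smul 1 n
    rw [iteratedFDeriv_apply_eq_iteratedDeriv_mul_prod, Finset.prod_const_one, one_smul,
      FormalMultilinearSeries.ofScalars_apply_eq] at this
    simpa using this.symm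
  have hgder : iteratedDeriv n (fun z ↦ 1 - w * f z) 0 = -(w * (n.factorial * a n)) := by
    rw [iteratedDeriv_const_sub (Nat.pos_of_ne_zero hn), iteratedDeriv_neg,
      iteratedDeriv_const_mul_field, hder]
  have hdiff : DifferentiableOn ℂ f (ball 0 1) := fun z hz ↦
    (hps.analyticAt_of_mem
      (by simpa [← ofReal_norm] using hz)).differentiableAt.differentiableWithinAt
  have key : ∀ R ∈ Set.Ioo (0 : ℝ) 1, ‖a n‖ * R ^ n ≤ 2 * (1 - ‖a 0‖) := by
    rintro R ⟨hR0, hR1⟩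
    have hg : DiffContOnCl ℂ (fun z ↦ 1 - w * f z) (ball 0 R) := by
      refine DifferentiableOn.diffContOnCl ?_
      rw [closure_ball _ hR0.ne']
      exact ((hdiff.mono (closedBall_subset_ball hR1)).const_mul w).const_sub 1
    have h := hg.norm_iteratedDeriv_div_factorial_mul_pow_le hR0 (fun z hz ↦ by
      have hz1 : ‖z‖ < 1 := by rw [mem_sphere_zero_iff_norm.1 hz]; exact hR1
      have hle : (w * f z).re ≤ 1 := (re_le_norm _).trans (by simpa [hw] using hb z hz1)
      simpa using hle) hn
    rw [hgder, hf0, hwa] at h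
    simpa [hw, n.factorial_ne_zero] using h
  have hlim : Filter.Tendsto (fun R : ℝ ↦ ‖a n‖ * R ^ n) (nhdsWithin 1 (Set.Iio 1))
      (nhds (‖a n‖ * 1 ^ n)) :=
    (Continuous.tendsto (by fun_prop) 1).mono_left nhdsWithin_le_nhds
  rw [one_pow, mul_one] at hlim
  exact le_of_tendsto hlim (Filter.eventually_of_mem (Ioo_mem_nhdsLT one_pos) key)

/-- Bohr's inequality: if `f(z) = Σ aₙ zⁿ` is analytic in the unit disk with `|f| ≤ 1`,
then `Σ_{n≥1} |aₙ| rⁿ ≤ 1 - |a₀|` for `0 ≤ r ≤ 1/3`. -/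
theorem stmt_17 (f : ℂ → ℂ) (a : ℕ → ℂ)
    (hf : ∀ z : ℂ, ‖z‖ < 1 → HasSum (fun n : ℕ => a n * z ^ n) (f z))
    (hb : ∀ z : ℂ, ‖z‖ < 1 → ‖f z‖ ≤ 1)
    (r : ℝ) (hr0 : 0 ≤ r) (hr1 : r ≤ 1 / 3) :
    ∑' n : ℕ, ‖a (n + 1)‖ * r ^ (n + 1) ≤ 1 - ‖a 0‖ := by
  have hgeom : HasSum (fun n : ℕ ↦ 2 * (1 - ‖a 0‖) * (1 / 3 : ℝ) ^ (n + 1)) (1 - ‖a 0‖) := by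
    have h := (hasSum_geometric_of_lt_one (r := (1 / 3 : ℝ)) (by norm_num)
      (by norm_num)).mul_left (2 * (1 - ‖a 0‖) * (1 / 3))
    rw [show 2 * (1 - ‖a 0‖) * (1 / 3) * (1 - 1 / 3 : ℝ)⁻¹ = 1 - ‖a 0‖ by norm_num; ring] at h
    simpa only [pow_succ', mul_assoc] using h
  have hle : ∀ n : ℕ, ‖a (n + 1)‖ * r ^ (n + 1) ≤ 2 * (1 - ‖a 0‖) * (1 / 3 : ℝ) ^ (n + 1) := by
    intro n
    have hcoeff := norm_coeff_le_of_norm_le_one hf hb n.succ_ne_zero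
    exact mul_le_mul hcoeff (pow_le_pow_left₀ hr0 hr1 _) (by positivity)
      ((norm_nonneg _).trans hcoeff)
  have hsum := Summable.of_nonneg_of_le (fun n ↦ by positivity) hle hgeom.summable
  exact (hsum.tsum_le_tsum hle hgeom.summable).trans_eq hgeom.tsum_eq
end

section
/- If f(z) = Σ_{n=0}^∞ a_n z^n is analytic in the open unit disk 𝔻 with |f(z)| ≤ 1 for all z ∈ 𝔻, then Σ_{n=1}^∞ |a_n| r^n ≤ 1 − |a_0|² for every r with 0 ≤ r ≤ 1/2. -/
open Complex in
theorem integral_exp_int_mul_I (m : ℤ) :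
    ∫ θ in (0 : ℝ)..2 * Real.pi, exp (m * θ * I) = if m = 0 then 2 * (Real.pi : ℂ) else 0 := by
  split_ifs with h
  · simp [h]
  · have hm : (m * I : ℂ) ≠ 0 := mul_ne_zero (by exact_mod_cast h) I_ne_zero
    have h1 : ∀ θ : ℝ, exp (m * θ * I) = exp (m * I * θ) := fun θ => by ring_nf
    simp_rw [h1]
    rw [integral_exp_mul_complex hm]
    have h2 : (m * I * ((2 * Real.pi : ℝ) : ℂ) : ℂ) = m * (2 * Real.pi * I) := by
      push_cast; ring
    rw [h2, exp_int_mul_two_pi_mul_I]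
    simp

open Complex in
/-- The kernel `e^{-inθ} (1 + w e^{inθ})²` extracts `aₙ + 2 w a₀` from a power series. -/
theorem integral_exp_mul_kernel (w : ℂ) {n : ℕ} (hn : n ≠ 0) (j : ℕ) :
    ∫ θ in (0 : ℝ)..2 * Real.pi,
      exp (θ * I) ^ j * (exp (-(n * θ * I)) * (1 + w * exp (n * θ * I)) ^ 2) =
      2 * Real.pi * ((if j = n then 1 else 0) + if j = 0 then 2 * w else 0) := by
  have h : ∀ θ : ℝ, exp (θ * I) ^ j * (exp (-(n * θ * I)) * (1 + w * exp (n * θ * I)) ^ 2) =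
      exp (((j - n : ℤ) : ℂ) * θ * I) + 2 * w * exp (((j : ℤ) : ℂ) * θ * I)
        + w ^ 2 * exp (((j + n : ℤ) : ℂ) * θ * I) := by
    intro θ
    have e1 : exp (-(n * θ * I)) * exp (n * θ * I) = 1 := by rw [← exp_add]; simp
    have e2 : exp (((j - n : ℤ) : ℂ) * θ * I) = exp (θ * I) ^ j * exp (-(n * θ * I)) := by
      rw [← exp_nat_mul, ← exp_add]; push_cast; ring_nf
    have e3 : exp (((j : ℤ) : ℂ) * θ * I) = exp (θ * I) ^ j := by
      rw [← exp_nat_mul]; push_cast; ring_nf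
    have e4 : exp (((j + n : ℤ) : ℂ) * θ * I) = exp (θ * I) ^ j * exp (n * θ * I) := by
      rw [← exp_nat_mul, ← exp_add]; push_cast; ring_nf
    rw [e2, e3, e4]
    linear_combination
      exp (θ * I) ^ j * (2 * w + w ^ 2 * exp (n * θ * I)) * e1
  simp_rw [h]
  rw [intervalIntegral.integral_add, intervalIntegral.integral_add,
    intervalIntegral.integral_const_mul, intervalIntegral.integral_const_mul,
    integral_exp_int_mul_I, integral_exp_int_mul_I, integral_exp_int_mul_I]
  · have h1 : ((j : ℤ) - n = 0) ↔ j = n := by omega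
    have h2 : ¬ ((j : ℤ) + n = 0) := by omega
    have h3 : ((j : ℤ) = 0) ↔ j = 0 := by omega
    simp only [h1, h2, h3, if_false]
    split_ifs <;> ring
  all_goals exact Continuous.intervalIntegrable (by fun_prop) _ _

open Complex in
theorem integral_norm_one_add_mul_exp_sq (w : ℂ) {n : ℕ} (hn : n ≠ 0) :
    ∫ θ in (0 : ℝ)..2 * Real.pi, ‖1 + w * exp (n * θ * I)‖ ^ 2 =
      2 * Real.pi * (1 + ‖w‖ ^ 2) := by
  have h : ∀ θ : ℝ, ‖1 + w * exp (n * θ * I)‖ ^ 2 =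
      (1 + ‖w‖ ^ 2) + reCLM (2 * w * exp (((n : ℤ) : ℂ) * θ * I)) := by
    intro θ
    have hexp : ‖exp (n * θ * I)‖ = 1 := by
      simpa using norm_exp_ofReal_mul_I (n * θ)
    have hw : ‖w‖ ^ 2 = ‖w * exp (n * θ * I)‖ ^ 2 := by rw [norm_mul, hexp, mul_one]
    rw [hw, Int.cast_natCast, mul_assoc]
    generalize w * exp (n * θ * I) = u
    simp only [← normSq_eq_norm_sq, normSq_apply, reCLM_apply]
    simp
    ring
  have hi : IntervalIntegrable (fun θ : ℝ => 2 * w * exp (((n : ℤ) : ℂ) * θ * I))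
      MeasureTheory.volume 0 (2 * Real.pi) :=
    Continuous.intervalIntegrable (by fun_prop) _ _
  simp_rw [h]
  rw [intervalIntegral.integral_add (by simp)
    (Continuous.intervalIntegrable (by fun_prop) _ _),
    reCLM.intervalIntegral_comp_comm hi, intervalIntegral.integral_const_mul,
    integral_exp_int_mul_I]
  simp [hn]
  ring

open Complex in
theorem norm_coeff_mul_pow_add_le {f : ℂ → ℂ} {a : ℕ → ℂ}
    (hf : ∀ z : ℂ, ‖z‖ < 1 → HasSum (fun n : ℕ => a n * z ^ n) (f z))
    (hb : ∀ z : ℂ, ‖z‖ < 1 → ‖f z‖ ≤ 1) (w : ℂ) {n : ℕ} (hn : n ≠ 0)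
    {ρ : ℝ} (hρ0 : 0 ≤ ρ) (hρ1 : ρ < 1) :
    ‖a n * (ρ : ℂ) ^ n + 2 * w * a 0‖ ≤ 1 + ‖w‖ ^ 2 := by
  set K : ℝ → ℂ := fun θ => exp (-(n * θ * I)) * (1 + w * exp (n * θ * I)) ^ 2 with hK
  have hKc : Continuous K := by fun_prop
  have hKn : ∀ θ, ‖K θ‖ = ‖1 + w * exp (n * θ * I)‖ ^ 2 := by
    intro θ
    have hexp : ‖exp (-(n * θ * I))‖ = 1 := by
      simpa using norm_exp_ofReal_mul_I (-(n * θ))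
    simp only [hK, norm_mul, norm_pow, hexp, one_mul]
  have hz : ∀ θ : ℝ, ‖(ρ : ℂ) * exp (θ * I)‖ = ρ := by
    intro θ
    rw [norm_mul, norm_exp_ofReal_mul_I, mul_one, norm_real, Real.norm_of_nonneg hρ0]
  have hsum : Summable fun j : ℕ => ‖a j‖ * ρ ^ j := by
    have := (hf ρ (by rwa [norm_real, Real.norm_of_nonneg hρ0])).summable.norm
    simpa [abs_of_nonneg hρ0] using this
  have h1 : HasSum (fun j : ℕ => ∫ θ in (0 : ℝ)..2 * Real.pi,
      a j * ((ρ : ℂ) * exp (θ * I)) ^ j * K θ)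
      (∫ θ in (0 : ℝ)..2 * Real.pi, f (ρ * exp (θ * I)) * K θ) := by
    refine intervalIntegral.hasSum_integral_of_dominated_convergence
      (fun j θ => ‖a j‖ * ρ ^ j * ‖K θ‖) ?_ ?_ ?_ ?_ ?_
    · exact fun j => Continuous.aestronglyMeasurable (by fun_prop)
    · refine fun j => .of_forall fun θ _ => ?_
      rw [norm_mul, norm_mul, norm_pow, hz]
    · exact .of_forall fun θ _ => hsum.mul_right _
    · simp_rw [tsum_mul_right]
      exact Continuous.intervalIntegrable (by fun_prop) _ _
    · exact .of_forall fun θ _ => (hf _ (by rwa [hz])).mul_right _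
  have h2 : ∀ j : ℕ, ∫ θ in (0 : ℝ)..2 * Real.pi, a j * ((ρ : ℂ) * exp (θ * I)) ^ j * K θ =
      a j * (ρ : ℂ) ^ j *
        (2 * Real.pi * ((if j = n then 1 else 0) + if j = 0 then 2 * w else 0)) := by
    intro j
    rw [← integral_exp_mul_kernel w hn j, ← intervalIntegral.integral_const_mul]
    refine intervalIntegral.integral_congr fun θ _ => ?_
    simp only [hK]
    ring
  simp_rw [h2] at h1
  have h3 := hasSum_sum_of_ne_finset_zero (s := {0, n}) (f := fun j : ℕ => a j * (ρ : ℂ) ^ j *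
      (2 * Real.pi * ((if j = n then 1 else 0) + if j = 0 then 2 * w else 0)))
    (L := .unconditional ℕ) (by
    intro j hj
    simp only [Finset.mem_insert, Finset.mem_singleton, not_or] at hj
    simp [hj.1, hj.2])
  have h4 := h1.unique h3
  rw [Finset.sum_pair hn.symm] at h4
  have h5 : ‖∫ θ in (0 : ℝ)..2 * Real.pi, f (ρ * exp (θ * I)) * K θ‖ ≤
      2 * Real.pi * (1 + ‖w‖ ^ 2) := by
    rw [← integral_norm_one_add_mul_exp_sq w hn]
    refine intervalIntegral.norm_integral_le_of_norm_le Real.two_pi_pos.le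
      (.of_forall fun θ _ => ?_) (Continuous.intervalIntegrable (by fun_prop) _ _)
    rw [norm_mul, hKn]
    exact mul_le_of_le_one_left (by positivity) (hb _ (by rwa [hz]))
  have h6 : (∫ θ in (0 : ℝ)..2 * Real.pi, f (ρ * exp (θ * I)) * K θ) =
      ((2 * Real.pi : ℝ) : ℂ) * (a n * (ρ : ℂ) ^ n + 2 * w * a 0) := by
    rw [h4]
    simp [hn, hn.symm]
    ring
  rw [h6, norm_mul, norm_real, Real.norm_of_nonneg Real.two_pi_pos.le] at h5
  exact le_of_mul_le_mul_left h5 Real.two_pi_pos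

/-- The **Wiener inequality** for the coefficients of a function bounded by `1` on the disk. -/
theorem norm_coeff_le_one_sub_norm_sq {f : ℂ → ℂ} {a : ℕ → ℂ}
    (hf : ∀ z : ℂ, ‖z‖ < 1 → HasSum (fun n : ℕ => a n * z ^ n) (f z))
    (hb : ∀ z : ℂ, ‖z‖ < 1 → ‖f z‖ ≤ 1) {n : ℕ} (hn : n ≠ 0) :
    ‖a n‖ ≤ 1 - ‖a 0‖ ^ 2 := by
  have key : ∀ w : ℂ, ‖a n + 2 * w * a 0‖ ≤ 1 + ‖w‖ ^ 2 := by
    intro w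
    have hc : Continuous fun ρ : ℝ => ‖a n * (ρ : ℂ) ^ n + 2 * w * a 0‖ := by fun_prop
    have ht := (hc.tendsto 1).mono_left (nhdsWithin_le_nhds (s := Set.Iio 1))
    simp only [Complex.ofReal_one, one_pow, mul_one] at ht
    refine le_of_tendsto ht ?_
    filter_upwards [Ioo_mem_nhdsLT (zero_lt_one' ℝ)] with ρ hρ
    exact norm_coeff_mul_pow_add_le hf hb w hn hρ.1.le hρ.2
  rcases eq_or_ne (a n) 0 with h0 | h0
  · have h := key (starRingEnd ℂ (a 0))
    rw [h0, zero_add, mul_assoc, ← Complex.normSq_eq_conj_mul_self,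
      Complex.normSq_eq_norm_sq] at h
    simp at h
    rw [h0, norm_zero]
    linarith
  · have hn0 : ‖a n‖ ≠ 0 := norm_ne_zero_iff.mpr h0
    have h := key (starRingEnd ℂ (a 0) * (a n / ‖a n‖))
    have hw : ‖starRingEnd ℂ (a 0) * (a n / ‖a n‖)‖ = ‖a 0‖ := by
      simp [hn0]
    have he : a n + 2 * (starRingEnd ℂ (a 0) * (a n / ‖a n‖)) * a 0 =
        a n / ‖a n‖ * ((‖a n‖ + 2 * ‖a 0‖ ^ 2 : ℝ) : ℂ) := by
      have hn0' : (‖a n‖ : ℂ) ≠ 0 := by exact_mod_cast hn0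
      have hs : starRingEnd ℂ (a 0) * a 0 = (‖a 0‖ : ℂ) ^ 2 := Complex.conj_mul' _
      push_cast
      field_simp
      linear_combination 2 * hs
    rw [hw, he, norm_mul, Complex.norm_real, Real.norm_of_nonneg (by positivity)] at h
    simp [hn0] at h
    linarith

/-- If `f(z) = Σ aₙ zⁿ` is analytic in the unit disk with `|f| ≤ 1`, then
`Σ_{n≥1} |aₙ| rⁿ ≤ 1 - |a₀|²` for `0 ≤ r ≤ 1/2`. -/
theorem stmt_18 (f : ℂ → ℂ) (a : ℕ → ℂ)
    (hf : ∀ z : ℂ, ‖z‖ < 1 → HasSum (fun n : ℕ => a n * z ^ n) (f z))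
    (hb : ∀ z : ℂ, ‖z‖ < 1 → ‖f z‖ ≤ 1)
    (r : ℝ) (hr0 : 0 ≤ r) (hr1 : r ≤ 1 / 2) :
    ∑' n : ℕ, ‖a (n + 1)‖ * r ^ (n + 1) ≤ 1 - ‖a 0‖ ^ 2 := by
  have hc : ∀ n : ℕ, ‖a (n + 1)‖ ≤ 1 - ‖a 0‖ ^ 2 := fun n =>
    norm_coeff_le_one_sub_norm_sq hf hb n.succ_ne_zero
  have hC : 0 ≤ 1 - ‖a 0‖ ^ 2 := (norm_nonneg _).trans (hc 0)
  have hg : HasSum (fun n : ℕ => (1 - ‖a 0‖ ^ 2) * (1 / 2 * (1 / 2 : ℝ) ^ n))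
      ((1 - ‖a 0‖ ^ 2) * (1 / 2 * 2)) := (hasSum_geometric_two.mul_left _).mul_left _
  have h := tsum_of_norm_bounded (f := fun n : ℕ => ‖a (n + 1)‖ * r ^ (n + 1)) hg fun n => by
    rw [Real.norm_of_nonneg (by positivity), ← pow_succ']
    exact mul_le_mul (hc n) (pow_le_pow_left₀ hr0 hr1 _) (by positivity) hC
  calc _ ≤ _ := Real.le_norm_self _
    _ ≤ _ := h
    _ = _ := by ring
end

section
/- If f(z) = Σ_{n=1}^∞ a_n z^n is analytic in the open unit disk 𝔻 with f(0) = 0 and |f(z)| ≤ 1 for all z ∈ 𝔻, then Σ_{n=1}^∞ |a_n| r^n ≤ 1 for every r with 0 ≤ r ≤ 1/√2. -/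
open MeasureTheory in
/-- A power series bounded by `1` on the unit disk has `∑ |aₙ|² ρ²ⁿ ≤ 1` for each `ρ < 1`. -/
lemma sum_norm_coeff_mul_pow_sq_le_one {f : ℂ → ℂ} {a : ℕ → ℂ}
    (hf : ∀ z : ℂ, ‖z‖ < 1 → HasSum (fun n : ℕ => a n * z ^ n) (f z))
    (hb : ∀ z : ℂ, ‖z‖ < 1 → ‖f z‖ ≤ 1) {ρ : ℝ} (hρ0 : 0 ≤ ρ) (hρ1 : ρ < 1) (s : Finset ℕ) :
    ∑ n ∈ s, (‖a n‖ * ρ ^ n) ^ 2 ≤ 1 := by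
  have : Fact ((0 : ℝ) < 1) := ⟨one_pos⟩
  have hρ : ‖(ρ : ℂ)‖ = ρ := by simp [abs_of_nonneg hρ0]
  let u : ℕ → C(AddCircle (1 : ℝ), ℂ) := fun n => (a n * (ρ : ℂ) ^ n) • fourier (n : ℤ)
  have hu : Summable u := by
    refine Summable.of_norm ?_
    refine (hf ρ (by rwa [hρ])).summable.norm.congr fun n => ?_
    simp [u, norm_smul, fourier_norm]
  obtain ⟨g, hg⟩ := hu
  have hg1 : ‖g‖ ≤ 1 := by
    refine (ContinuousMap.norm_le _ zero_le_one).2 fun x => ?_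
    have hz : ‖(ρ : ℂ) * (AddCircle.toCircle x : ℂ)‖ < 1 := by
      rwa [norm_mul, hρ, Circle.norm_coe, mul_one]
    have hx : HasSum (fun n => u n x) (g x) :=
      hg.mapL (ContinuousMap.evalCLM ℂ x)
    have heq : g x = f ((ρ : ℂ) * (AddCircle.toCircle x : ℂ)) := by
      refine hx.unique ?_
      refine (hf _ hz).congr_fun ?_
      intro n
      simp [u, fourier_apply, AddCircle.toCircle_nsmul, mul_pow, mul_assoc]
    rw [heq]
    exact hb _ hz
  let L := ContinuousMap.toLp (E := ℂ) 2 (AddCircle.haarAddCircle (T := (1 : ℝ))) ℂ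
  have hL : ‖L g‖ ≤ 1 := by
    refine (L.le_of_opNorm_le (ContinuousMap.toLp_norm_le _) g).trans ?_
    simpa [measureUnivNNReal] using hg1
  have hinner (m : ℕ) : inner ℂ (fourierLp (T := 1) 2 (m : ℤ)) (L g) = a m * (ρ : ℂ) ^ m := by
    have h1 := (hg.mapL L).mapL (innerSL ℂ (fourierLp (T := 1) 2 (m : ℤ)))
    refine h1.unique ?_
    have h2 := hasSum_ite_eq m (a m * (ρ : ℂ) ^ m)
    refine h2.congr_fun ?_
    intro n
    have h3 := orthonormal_iff_ite.1 (orthonormal_fourier (T := 1)) (m : ℤ) (n : ℤ)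
    have h4 : L (u n) = (a n * (ρ : ℂ) ^ n) • fourierLp (T := 1) 2 (n : ℤ) := by
      simp [u, fourierLp, L]
    rw [h4, innerSL_apply_apply, inner_smul_right, h3]
    by_cases h : n = m
    · subst h; simp
    · have h' : m ≠ n := fun e => h e.symm
      simp [h, h']
  have hB := ((orthonormal_fourier (T := 1)).comp (fun n : ℕ => (n : ℤ))
    Nat.cast_injective).sum_inner_products_le (L g) (s := s)
  calc ∑ n ∈ s, (‖a n‖ * ρ ^ n) ^ 2
      = ∑ n ∈ s, ‖inner ℂ (fourierLp (T := 1) 2 (n : ℤ)) (L g)‖ ^ 2 := by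
        refine Finset.sum_congr rfl fun n _ => ?_
        rw [hinner, norm_mul, norm_pow, hρ]
    _ ≤ ‖L g‖ ^ 2 := hB
    _ ≤ 1 := pow_le_one₀ (norm_nonneg _) hL

/-- A power series bounded by `1` on the unit disk has `∑ |aₙ|² ≤ 1`. -/
lemma sum_norm_coeff_sq_le_one {f : ℂ → ℂ} {a : ℕ → ℂ}
    (hf : ∀ z : ℂ, ‖z‖ < 1 → HasSum (fun n : ℕ => a n * z ^ n) (f z))
    (hb : ∀ z : ℂ, ‖z‖ < 1 → ‖f z‖ ≤ 1) (s : Finset ℕ) :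
    ∑ n ∈ s, ‖a n‖ ^ 2 ≤ 1 := by
  have hc : Continuous fun ρ : ℝ => ∑ n ∈ s, (‖a n‖ * ρ ^ n) ^ 2 := by fun_prop
  have ht := (hc.tendsto 1).mono_left (nhdsWithin_le_nhds (s := Set.Iio (1 : ℝ)))
  simp only [one_pow, mul_one] at ht
  refine le_of_tendsto ht ?_
  filter_upwards [Ioo_mem_nhdsLT (zero_lt_one' ℝ)] with ρ hρ
  exact sum_norm_coeff_mul_pow_sq_le_one hf hb hρ.1.le hρ.2 s

/-- If `f(z) = Σ_{n≥1} aₙ zⁿ` is analytic in the unit disk with `f(0) = 0` and `|f| ≤ 1`,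
then `Σ_{n≥1} |aₙ| rⁿ ≤ 1` for `0 ≤ r ≤ 1/√2`. -/
theorem stmt_19 (f : ℂ → ℂ) (a : ℕ → ℂ) (h0 : a 0 = 0)
    (hf : ∀ z : ℂ, ‖z‖ < 1 → HasSum (fun n : ℕ => a n * z ^ n) (f z))
    (hb : ∀ z : ℂ, ‖z‖ < 1 → ‖f z‖ ≤ 1)
    (r : ℝ) (hr0 : 0 ≤ r) (hr1 : r ≤ 1 / Real.sqrt 2) :
    ∑' n : ℕ, ‖a (n + 1)‖ * r ^ (n + 1) ≤ 1 := by
  have hr2 : r ^ 2 ≤ 1 / 2 := by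
    calc r ^ 2 ≤ (1 / Real.sqrt 2) ^ 2 := by gcongr
      _ = 1 / 2 := by rw [div_pow, Real.sq_sqrt zero_le_two, one_pow]
  refine Real.tsum_le_of_sum_range_le (fun n => by positivity) fun N => ?_
  have ha : ∑ n ∈ Finset.range N, ‖a (n + 1)‖ ^ 2 ≤ 1 := by
    have h := sum_norm_coeff_sq_le_one hf hb (Finset.range (N + 1))
    rw [Finset.sum_range_succ'] at h
    simpa [h0] using h
  have hgeom : ∑ n ∈ Finset.range N, (r ^ (n + 1)) ^ 2 ≤ 1 := by
    calc ∑ n ∈ Finset.range N, (r ^ (n + 1)) ^ 2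
        ≤ ∑ n ∈ Finset.range N, (1 / 2 : ℝ) ^ n * (1 / 2) := by
          refine Finset.sum_le_sum fun n _ => ?_
          rw [pow_right_comm, ← pow_succ]
          gcongr
      _ ≤ 2 * (1 / 2) := by
          rw [← Finset.sum_mul]
          gcongr
          exact sum_geometric_two_le N
      _ = 1 := by norm_num
  refine (sq_le_one_iff₀ (Finset.sum_nonneg fun n _ => by positivity)).1 ?_
  refine (Finset.sum_mul_sq_le_sq_mul_sq _ _ _).trans ?_
  exact mul_le_one₀ ha (Finset.sum_nonneg fun n _ => by positivity) hgeom
end
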